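/- (Functional inequalities for sampling without replacement and symmetric functions.) For every symmetric function f : Ω_{κ,n} → ℝ (i.e. f(σω) = f(ω) for all σ ∈ S_n), the following hold: Ent_{P_{κ,n}}(f²) ≤ (4 log(N/κ_min)(1 − n/N)/log 2) · E_{κ,n}[ 𝔥(f)² ] where κ_min = min{κ_1,…,κ_L}; Ent_{P_{κ,n}}(e^f) ≤ 2(1 − n/N) · E_{κ,n}[ 𝔥(f)² e^f ]; and Ent_{P_{κ,n}}(e^f) ≤ 4(1 − n/N) · E_{κ,n}[ 𝔥⁺(f)² e^f ]. -/

import Mathlib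

open Finset Real
open scoped Classical

noncomputable section

/-- The multislice `Ω_κ ⊆ 𝒳^N`: vectors with values in `{x ℓ}` where the value `x ℓ`
appears exactly `κ ℓ` times. -/
def multislice (L N : ℕ) (κ : Fin L → ℕ) (x : Fin L → ℝ) : Finset (Fin N → ℝ) :=
  (Fintype.piFinset fun _ : Fin N => Finset.image x Finset.univ).filter
    (fun ω => ∀ ℓ : Fin L, (Finset.univ.filter fun i => ω i = x ℓ).card = κ ℓ)

/-- Expectation with respect to the uniform distribution on a finite set. -/
def uexpect {α : Type*} (Ω : Finset α) (f : α → ℝ) : ℝ := (∑ ω ∈ Ω, f ω) / Ω.card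

/-- Probability of an event with respect to the uniform distribution on a finite set. -/
def uprob {α : Type*} (Ω : Finset α) (p : α → Prop) : ℝ :=
  ((Ω.filter p).card : ℝ) / Ω.card

/-- `Ω_{κ,n}`: the image of the multislice under the projection onto the first `n`
coordinates (`n` out of `N` sampling without replacement). -/
def msProj (L N n : ℕ) (κ : Fin L → ℕ) (x : Fin L → ℝ) (hn : n ≤ N) :
    Finset (Fin n → ℝ) :=
  (multislice L N κ x).image (fun ω => fun i : Fin n => ω (Fin.castLE hn i))

/-- Expectation `E_{κ,n}` with respect to `P_{κ,n}`, the push-forward of the uniform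
distribution `P_κ` on the multislice under the projection onto the first `n` coordinates. -/
def msExpectN (L N n : ℕ) (κ : Fin L → ℕ) (x : Fin L → ℝ) (hn : n ≤ N)
    (f : (Fin n → ℝ) → ℝ) : ℝ :=
  uexpect (multislice L N κ x) (fun ω => f (fun i : Fin n => ω (Fin.castLE hn i)))

/-- Probability `P_{κ,n}` of an event, i.e. the push-forward of the uniform distribution
`P_κ` on the multislice under the projection onto the first `n` coordinates. -/
def msProbN (L N n : ℕ) (κ : Fin L → ℕ) (x : Fin L → ℝ) (hn : n ≤ N)
    (p : (Fin n → ℝ) → Prop) : ℝ :=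
  uprob (multislice L N κ x) (fun ω => p (fun i : Fin n => ω (Fin.castLE hn i)))

/-- `𝔥(f)(ω)² = (1/2) ∑_i (sup_{ω_i'} f(ω_{i^c}, ω_i') − inf_{ω_i''} f(ω_{i^c}, ω_i''))²`,
where the supremum and infimum range over admissible replacements of the `i`-th
coordinate. -/
def msHSq (L N n : ℕ) (κ : Fin L → ℕ) (x : Fin L → ℝ) (hn : n ≤ N)
    (f : (Fin n → ℝ) → ℝ) (ω : Fin n → ℝ) : ℝ :=
  (1 / 2) * ∑ i : Fin n,
    (sSup { r : ℝ | ∃ ω' ∈ msProj L N n κ x hn,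
        (∀ j : Fin n, j ≠ i → ω' j = ω j) ∧ r = f ω' } -
      sInf { r : ℝ | ∃ ω' ∈ msProj L N n κ x hn,
        (∀ j : Fin n, j ≠ i → ω' j = ω j) ∧ r = f ω' }) ^ 2

/-- `𝔥⁺(f)(ω)² = (1/2) ∑_i (f(ω) − inf_{ω_i'} f(ω_{i^c}, ω_i'))²`, where the infimum
ranges over admissible replacements of the `i`-th coordinate. -/
def msHPlusSq (L N n : ℕ) (κ : Fin L → ℕ) (x : Fin L → ℝ) (hn : n ≤ N)
    (f : (Fin n → ℝ) → ℝ) (ω : Fin n → ℝ) : ℝ :=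
  (1 / 2) * ∑ i : Fin n,
    (f ω - sInf { r : ℝ | ∃ ω' ∈ msProj L N n κ x hn,
        (∀ j : Fin n, j ≠ i → ω' j = ω j) ∧ r = f ω' }) ^ 2

/-- The entropy functional `Ent_μ(g) = E_μ[g log g] − (E_μ g) log (E_μ g)` with respect to
the uniform distribution on a finite set. -/
def uent {α : Type*} (Ω : Finset α) (g : α → ℝ) : ℝ :=
  uexpect Ω (fun ω => g ω * Real.log (g ω)) - uexpect Ω g * Real.log (uexpect Ω g)

/-- The entropy functional with respect to `P_{κ,n}` (the push-forward of `P_κ` under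
the projection onto the first `n` coordinates). -/
def msEntN (L N n : ℕ) (κ : Fin L → ℕ) (x : Fin L → ℝ) (hn : n ≤ N)
    (g : (Fin n → ℝ) → ℝ) : ℝ :=
  uent (multislice L N κ x) (fun ω => g (fun i : Fin n => ω (Fin.castLE hn i)))

set_option linter.unusedSectionVars false

section Colorings

variable {ι K : Type*} [Fintype ι] [DecidableEq ι]

/-- The colorings obtained from `c` by permuting the sites in `T`. -/
def colorOrbit (T : Finset ι) (c : ι → K) : Finset (ι → K) :=
  (univ.filter fun σ : Equiv.Perm ι => ∀ i, i ∉ T → σ i = i).image fun σ => c ∘ σ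

/-- The number of sites of `T` with color `ℓ`. -/
def colorCount (T : Finset ι) (c : ι → K) (ℓ : K) : ℕ := (T.filter fun i => c i = ℓ).card

lemma mem_colorOrbit {T : Finset ι} {c d : ι → K} :
    d ∈ colorOrbit T c ↔ ∃ σ : Equiv.Perm ι, (∀ i, i ∉ T → σ i = i) ∧ d = c ∘ σ := by
  simp [colorOrbit, eq_comm]

lemma colorCount_comp_perm {T : Finset ι} (c : ι → K) {σ : Equiv.Perm ι}
    (hσ : ∀ i, i ∉ T → σ i = i) (ℓ : K) : colorCount T (c ∘ σ) ℓ = colorCount T c ℓ := by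
  have hT : ∀ i, i ∈ T ↔ σ i ∈ T := by
    intro i
    constructor
    · intro hi
      by_contra h
      have := hσ _ h
      rw [σ.injective this] at h
      exact h hi
    · intro hi
      by_contra h
      rw [hσ i h] at hi
      exact h hi
  unfold colorCount
  refine card_bij (fun i _ => σ i) ?_ (fun a _ b _ h => σ.injective h) ?_
  · intro i hi
    simp only [mem_filter, Function.comp] at hi ⊢
    exact ⟨(hT i).1 hi.1, hi.2⟩
  · intro j hj
    simp only [mem_filter] at hj
    refine ⟨σ.symm j, ?_, by simp⟩
    simp only [mem_filter, Function.comp, Equiv.apply_symm_apply]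
    exact ⟨(hT _).2 (by simpa using hj.1), hj.2⟩

lemma mem_colorOrbit_iff {T : Finset ι} {c d : ι → K} :
    d ∈ colorOrbit T c ↔
      (∀ i, i ∉ T → d i = c i) ∧ ∀ ℓ, colorCount T d ℓ = colorCount T c ℓ := by
  rw [mem_colorOrbit]
  constructor
  · rintro ⟨σ, hσ, rfl⟩
    exact ⟨fun i hi => by simp [hσ i hi], colorCount_comp_perm c hσ⟩
  · rintro ⟨h1, h2⟩
    have e : ∀ ℓ : K, Nonempty ({i : T // d i = ℓ} ≃ {i : T // c i = ℓ}) := by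
      intro ℓ
      refine Fintype.card_eq.1 ?_
      have key : ∀ b : ι → K, Fintype.card {i : T // b i = ℓ} = colorCount T b ℓ := by
        intro b
        rw [Fintype.card_subtype, colorCount, ← card_map (Function.Embedding.subtype _)]
        congr 1
        ext i
        simp [and_comm]
      rw [key, key, h2]
    let E : T ≃ T := Equiv.ofFiberEquiv (f := fun i : T => d i) (g := fun i : T => c i)
      fun ℓ => (e ℓ).some
    have hE : ∀ i : T, c (E i) = d i := fun i =>
      Equiv.ofFiberEquiv_map (f := fun i : T => d i) (g := fun i : T => c i) (fun ℓ => (e ℓ).some) i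
    refine ⟨Equiv.Perm.ofSubtype E, fun i hi => Equiv.Perm.ofSubtype_apply_of_not_mem E hi, ?_⟩
    ext i
    by_cases hi : i ∈ T
    · rw [Function.comp, Equiv.Perm.ofSubtype_apply_of_mem E hi, hE]
    · rw [Function.comp, Equiv.Perm.ofSubtype_apply_of_not_mem E hi, h1 i hi]

lemma self_mem_colorOrbit (T : Finset ι) (c : ι → K) : c ∈ colorOrbit T c :=
  mem_colorOrbit_iff.2 ⟨fun _ _ => rfl, fun _ => rfl⟩

lemma comp_perm_mem_colorOrbit {T : Finset ι} {c d : ι → K} (hd : d ∈ colorOrbit T c)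
    {σ : Equiv.Perm ι} (hσ : ∀ i, i ∉ T → σ i = i) : d ∘ σ ∈ colorOrbit T c := by
  obtain ⟨h1, h2⟩ := mem_colorOrbit_iff.1 hd
  refine mem_colorOrbit_iff.2 ⟨fun i hi => ?_, fun ℓ => ?_⟩
  · rw [Function.comp, hσ i hi, h1 i hi]
  · rw [colorCount_comp_perm d hσ, h2]

lemma swap_fixes {T : Finset ι} {i j : ι} (hi : i ∈ T) (hj : j ∈ T) (k : ι) (hk : k ∉ T) :
    Equiv.swap i j k = k :=
  Equiv.swap_apply_of_ne_of_ne (fun h => hk (h ▸ hi)) (fun h => hk (h ▸ hj))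

lemma comp_swap_comp_swap (c : ι → K) (i j : ι) :
    (c ∘ Equiv.swap i j) ∘ Equiv.swap i j = c := by
  ext k; simp

lemma comp_swap_of_eq {c : ι → K} {i j : ι} (h : c i = c j) : c ∘ Equiv.swap i j = c := by
  ext k
  rcases eq_or_ne k i with rfl | hi
  · simp [h]
  rcases eq_or_ne k j with rfl | hj
  · simp [h]
  simp [Equiv.swap_apply_of_ne_of_ne hi hj]

lemma sum_colorOrbit_comp_swap {T : Finset ι} (c : ι → K) {i j : ι} (hi : i ∈ T) (hj : j ∈ T)
    (h : (ι → K) → ℝ) :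
    ∑ d ∈ colorOrbit T c, h (d ∘ Equiv.swap i j) = ∑ d ∈ colorOrbit T c, h d := by
  refine sum_nbij' (fun d => d ∘ Equiv.swap i j) (fun d => d ∘ Equiv.swap i j) ?_ ?_ ?_ ?_ ?_
  · exact fun d hd => comp_perm_mem_colorOrbit hd (swap_fixes hi hj)
  · exact fun d hd => comp_perm_mem_colorOrbit hd (swap_fixes hi hj)
  · exact fun d _ => comp_swap_comp_swap d i j
  · exact fun d _ => comp_swap_comp_swap d i j
  · exact fun d _ => rfl

lemma colorCount_eq_of_mem {T : Finset ι} {c d : ι → K} (hd : d ∈ colorOrbit T c) (ℓ : K) :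
    colorCount T d ℓ = colorCount T c ℓ := (mem_colorOrbit_iff.1 hd).2 ℓ

lemma image_eq_of_mem {T : Finset ι} {c d : ι → K} (hd : d ∈ colorOrbit T c) :
    T.image d = T.image c := by
  have key : ∀ b : ι → K, ∀ ℓ, ℓ ∈ T.image b ↔ 0 < colorCount T b ℓ := by
    intro b ℓ
    rw [colorCount, card_pos, mem_image]
    constructor
    · rintro ⟨a, ha, h⟩; exact ⟨a, mem_filter.2 ⟨ha, h⟩⟩
    · rintro ⟨a, ha⟩; exact ⟨a, (mem_filter.1 ha).1, (mem_filter.1 ha).2⟩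
  ext ℓ
  rw [key, key, colorCount_eq_of_mem hd]

lemma apply_mem_image {T : Finset ι} {c d : ι → K} (hd : d ∈ colorOrbit T c) {i : ι}
    (hi : i ∈ T) : d i ∈ T.image c := by
  rw [← image_eq_of_mem hd]; exact mem_image_of_mem d hi

lemma colorCount_pos {T : Finset ι} {c : ι → K} {ℓ : K} (h : ℓ ∈ T.image c) :
    0 < colorCount T c ℓ := by
  obtain ⟨a, ha, h⟩ := mem_image.1 h
  exact card_pos.2 ⟨a, mem_filter.2 ⟨ha, h⟩⟩

lemma sum_colorCount (T : Finset ι) (c : ι → K) : ∑ ℓ ∈ T.image c, colorCount T c ℓ = T.card :=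
  (card_eq_sum_card_image c T).symm

lemma colorCount_sdiff {T A : Finset ι} (hA : A ⊆ T) (c : ι → K) (ℓ : K) :
    colorCount (T \ A) c ℓ + colorCount A c ℓ = colorCount T c ℓ := by
  unfold colorCount
  rw [← card_union_of_disjoint (disjoint_filter_filter sdiff_disjoint), ← filter_union,
    sdiff_union_of_subset hA]

lemma colorCount_congr {A : Finset ι} {c d : ι → K} (h : ∀ i ∈ A, c i = d i) (ℓ : K) :
    colorCount A c ℓ = colorCount A d ℓ := by
  unfold colorCount
  congr 1
  exact filter_congr fun i hi => by rw [h i hi]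

/-- Freezing the sites of `A` restricts an orbit to a smaller orbit. -/
lemma filter_colorOrbit_eqOn {T A : Finset ι} (hA : A ⊆ T) {c d : ι → K}
    (hd : d ∈ colorOrbit T c) :
    ((colorOrbit T c).filter fun e => ∀ i ∈ A, e i = d i) = colorOrbit (T \ A) d := by
  ext e
  rw [mem_filter, mem_colorOrbit_iff, mem_colorOrbit_iff]
  obtain ⟨h1, h2⟩ := mem_colorOrbit_iff.1 hd
  constructor
  · rintro ⟨⟨h3, h4⟩, h5⟩
    refine ⟨fun i hi => ?_, fun ℓ => ?_⟩
    · by_cases hiA : i ∈ A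
      · exact h5 i hiA
      · have : i ∉ T := fun h => hi (mem_sdiff.2 ⟨h, hiA⟩)
        rw [h3 i this, h1 i this]
    · have a1 := colorCount_sdiff hA e ℓ
      have a2 := colorCount_sdiff hA d ℓ
      have a3 := colorCount_congr h5 ℓ
      have a4 := h4 ℓ
      have a5 := h2 ℓ
      omega
  · rintro ⟨h3, h4⟩
    have h5 : ∀ i ∈ A, e i = d i := fun i hi => h3 i fun h => (mem_sdiff.1 h).2 hi
    refine ⟨⟨fun i hi => ?_, fun ℓ => ?_⟩, h5⟩
    · rw [h3 i fun h => hi (mem_sdiff.1 h).1, h1 i hi]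
    · have a1 := colorCount_sdiff hA e ℓ
      have a2 := colorCount_sdiff hA d ℓ
      have a3 := colorCount_congr h5 ℓ
      have a4 := h4 ℓ
      have a5 := h2 ℓ
      omega

lemma filter_colorOrbit_apply_eq {T : Finset ι} {i : ι} (hi : i ∈ T) {c d : ι → K}
    (hd : d ∈ colorOrbit T c) :
    ((colorOrbit T c).filter fun e => e i = d i) = colorOrbit (T.erase i) d := by
  rw [← sdiff_singleton_eq_erase, ← filter_colorOrbit_eqOn (singleton_subset_iff.2 hi) hd]
  simp

lemma filter_colorOrbit_level {T : Finset ι} (ℓ : K) {c d : ι → K} (hd : d ∈ colorOrbit T c) :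
    ((colorOrbit T c).filter fun e => (fun i => decide (e i = ℓ)) = fun i => decide (d i = ℓ)) =
      colorOrbit (T \ T.filter fun i => d i = ℓ) d := by
  rw [← filter_colorOrbit_eqOn (filter_subset _ _) hd]
  refine filter_congr fun e he => ?_
  constructor
  · intro h i hi
    have := congrFun h i
    simp only [decide_eq_decide] at this
    have hi' := (mem_filter.1 hi).2
    rw [this.2 hi', hi']
  · intro h
    have hsub : (T.filter fun i => d i = ℓ) ⊆ T.filter fun i => e i = ℓ := by
      intro i hi
      have := h i hi
      rw [mem_filter] at hi ⊢
      exact ⟨hi.1, this.trans hi.2⟩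
    have heq := eq_of_subset_of_card_le hsub (le_of_eq
      ((colorCount_eq_of_mem he ℓ).trans (colorCount_eq_of_mem hd ℓ).symm))
    ext i
    simp only [decide_eq_decide]
    by_cases hi : i ∈ T
    · have := Finset.ext_iff.1 heq i
      simp only [mem_filter, hi, true_and] at this
      exact this.symm
    · rw [(mem_colorOrbit_iff.1 he).1 i hi, (mem_colorOrbit_iff.1 hd).1 i hi]

end Colorings

/-- Unnormalised entropy of `g` with respect to the counting measure on `S`. -/
def entSum {α : Type*} (S : Finset α) (g : α → ℝ) : ℝ :=
  ∑ ω ∈ S, g ω * log (g ω) - (∑ ω ∈ S, g ω) * log ((∑ ω ∈ S, g ω) / S.card)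

lemma entSum_fiberwise {α β : Type*} (S : Finset α) (g : α → ℝ) (p : α → β) (B : Finset β)
    (hp : ∀ ω ∈ S, p ω ∈ B) :
    entSum S g = ∑ b ∈ B, entSum (S.filter fun ω => p ω = b) g +
      (∑ b ∈ B, (∑ ω ∈ S.filter fun ω => p ω = b, g ω) *
          log ((∑ ω ∈ S.filter fun ω => p ω = b, g ω) / (S.filter fun ω => p ω = b).card) -
        (∑ ω ∈ S, g ω) * log ((∑ ω ∈ S, g ω) / S.card)) := by
  unfold entSum
  rw [sum_sub_distrib, sum_fiberwise_of_maps_to hp]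
  ring

lemma entSum_of_forall_eq {α : Type*} {S : Finset α} {a : α} (h : ∀ ω ∈ S, ω = a)
    (g : α → ℝ) : entSum S g = 0 := by
  rcases S.eq_empty_or_nonempty with rfl | hS
  · simp [entSum]
  · rw [(eq_singleton_iff_nonempty_unique_mem.2 ⟨hS, h⟩ : S = {a})]
    simp [entSum]

/-- A nonnegative, positively homogeneous, jointly convex cost of moving between two values. -/
structure ConvexCost (Ψ : ℝ → ℝ → ℝ) : Prop where
  nonneg : ∀ x y, 0 < x → 0 < y → 0 ≤ Ψ x y
  self : ∀ x, Ψ x x = 0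
  smul : ∀ t x y, 0 < t → 0 < x → 0 < y → Ψ (t * x) (t * y) = t * Ψ x y
  add_le : ∀ x y x' y', 0 < x → 0 < y → 0 < x' → 0 < y' →
    Ψ (x + x') (y + y') ≤ Ψ x y + Ψ x' y'

lemma ConvexCost.sum_le {Ψ : ℝ → ℝ → ℝ} (hΨ : ConvexCost Ψ) {α : Type*} {s : Finset α}
    (hs : s.Nonempty) {u v : α → ℝ} (hu : ∀ a ∈ s, 0 < u a) (hv : ∀ a ∈ s, 0 < v a) :
    Ψ (∑ a ∈ s, u a) (∑ a ∈ s, v a) ≤ ∑ a ∈ s, Ψ (u a) (v a) := by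
  induction hs using Finset.Nonempty.cons_induction with
  | singleton a => simp
  | cons a s ha hs ih =>
    simp only [sum_cons]
    simp only [mem_cons, forall_eq_or_imp] at hu hv
    refine (hΨ.add_le _ _ _ _ hu.1 hv.1 (sum_pos hu.2 hs) (sum_pos hv.2 hs)).trans ?_
    linarith [ih hu.2 hv.2]

lemma convexCost_log : ConvexCost fun x y => (x - y) * (log x - log y) where
  nonneg x y hx hy := by
    rcases le_total x y with h | h
    · exact mul_nonneg_of_nonpos_of_nonpos (by linarith) (by linarith [log_le_log hx h])
    · exact mul_nonneg (by linarith) (by linarith [log_le_log hy h])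
  self x := by simp
  smul t x y ht hx hy := by
    rw [log_mul ht.ne' hx.ne', log_mul ht.ne' hy.ne']; ring
  add_le x y x' y' hx hy hx' hy' := by
    have key : ∀ x y X Y : ℝ, 0 < x → 0 < y → 0 < X → 0 < Y →
        x * (log X - log Y) ≤ x * (log x - log y) + (X * y / Y - x) := by
      intro x y X Y hx hy hX hY
      have h := log_le_sub_one_of_pos (x := X * y / (Y * x)) (by positivity)
      rw [log_div (by positivity) (by positivity), log_mul hX.ne' hy.ne',
        log_mul hY.ne' hx.ne'] at h
      have h2 := mul_le_mul_of_nonneg_left h hx.le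
      have h3 : x * (X * y / (Y * x) - 1) = X * y / Y - x := by field_simp
      linarith
    have k1 := key x y (x + x') (y + y') hx hy (by positivity) (by positivity)
    have k2 := key x' y' (x + x') (y + y') hx' hy' (by positivity) (by positivity)
    have k3 := key y x (y + y') (x + x') hy hx (by positivity) (by positivity)
    have k4 := key y' x' (y + y') (x + x') hy' hx' (by positivity) (by positivity)
    have e1 : (x + x') * y / (y + y') + (x + x') * y' / (y + y') = x + x' := by
      field_simp
    have e2 : (y + y') * x / (x + x') + (y + y') * x' / (x + x') = y + y' := by
      field_simp
    nlinarith

lemma convexCost_sqrt : ConvexCost fun x y => (√x - √y) ^ 2 where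
  nonneg x y _ _ := sq_nonneg _
  self x := by simp
  smul t x y ht hx hy := by
    rw [sqrt_mul ht.le, sqrt_mul ht.le, ← mul_sub, mul_pow, sq_sqrt ht.le]
  add_le x y x' y' hx hy hx' hy' := by
    have h1 := sq_sqrt hx.le
    have h2 := sq_sqrt hy.le
    have h3 := sq_sqrt hx'.le
    have h4 := sq_sqrt hy'.le
    have h5 := sq_sqrt (add_pos hx hx').le
    have h6 := sq_sqrt (add_pos hy hy').le
    have h : √x * √y + √x' * √y' ≤ √(x + x') * √(y + y') := by
      rw [← sqrt_mul (add_pos hx hx').le]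
      refine le_sqrt_of_sq_le ?_
      nlinarith [sq_nonneg (√x * √y' - √x' * √y)]
    nlinarith

section Colorings

variable {ι K : Type*} [Fintype ι] [DecidableEq ι]

/-- The energy at `c` of `g` under swaps of two sites of `T`, measured by the cost `Ψ`. -/
def swapEnergy (Ψ : ℝ → ℝ → ℝ) (T : Finset ι) (g : (ι → K) → ℝ) (c : ι → K) : ℝ :=
  ∑ i ∈ T, ∑ j ∈ T, Ψ (g c) (g (c ∘ Equiv.swap i j))

lemma swapEnergy_nonneg {Ψ : ℝ → ℝ → ℝ} (hΨ : ConvexCost Ψ) (T : Finset ι)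
    {g : (ι → K) → ℝ} (hg : ∀ c, 0 < g c) (c : ι → K) : 0 ≤ swapEnergy Ψ T g c :=
  sum_nonneg fun _ _ => sum_nonneg fun _ _ => hΨ.nonneg _ _ (hg _) (hg _)

/-- Exchanging the color `ℓ` at the site `i` for the color `m`. -/
lemma sum_swap_color {T : Finset ι} {i : ι} (hi : i ∈ T) (c : ι → K) (ℓ m : K)
    (h : (ι → K) → ℝ) :
    ∑ p ∈ (colorOrbit T c ×ˢ T).filter (fun p => p.1 i = ℓ ∧ p.1 p.2 = m),
        h (p.1 ∘ Equiv.swap i p.2) =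
      colorCount T c ℓ * ∑ d ∈ (colorOrbit T c).filter (fun d => d i = m), h d := by
  rw [sum_filter, sum_product_right]
  have h1 : ∀ j ∈ T, ∑ d ∈ colorOrbit T c,
      (if d i = ℓ ∧ d j = m then h (d ∘ Equiv.swap i j) else 0) =
      ∑ d ∈ colorOrbit T c, (if d j = ℓ ∧ d i = m then h d else 0) := by
    intro j hj
    rw [← sum_colorOrbit_comp_swap c hi hj]
    simp [comp_swap_comp_swap]
  rw [sum_congr rfl h1, sum_comm, sum_filter, mul_sum]
  refine sum_congr rfl fun d hd => ?_
  by_cases hm : d i = m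
  · simp only [hm, and_true, if_true]
    rw [← sum_filter, sum_const, nsmul_eq_mul, ← colorCount_eq_of_mem hd]
    rfl
  · simp [hm]

lemma sum_color_const {T : Finset ι} {i : ι} (c : ι → K) (ℓ m : K) (h : (ι → K) → ℝ) :
    ∑ p ∈ (colorOrbit T c ×ˢ T).filter (fun p => p.1 i = ℓ ∧ p.1 p.2 = m), h p.1 =
      colorCount T c m * ∑ d ∈ (colorOrbit T c).filter (fun d => d i = ℓ), h d := by
  rw [sum_filter, sum_product, sum_filter, mul_sum]
  refine sum_congr rfl fun d hd => ?_
  by_cases hl : d i = ℓ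
  · simp only [hl, true_and, if_true]
    rw [← sum_filter, sum_const, nsmul_eq_mul, ← colorCount_eq_of_mem hd]
    rfl
  · simp [hl]

lemma card_mul_card_filter {T : Finset ι} {i : ι} (hi : i ∈ T) (c : ι → K) (ℓ : K) :
    (T.card : ℝ) * ((colorOrbit T c).filter fun d => d i = ℓ).card =
      colorCount T c ℓ * (colorOrbit T c).card := by
  have h1 : ∀ m, (colorCount T c m : ℝ) * ((colorOrbit T c).filter fun d => d i = ℓ).card =
      colorCount T c ℓ * ((colorOrbit T c).filter fun d => d i = m).card := by
    intro m
    have a := sum_swap_color hi c ℓ m fun _ => 1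
    have b := sum_color_const (T := T) (i := i) c ℓ m fun _ => 1
    simp only [sum_const, nsmul_eq_mul, mul_one] at a b
    rw [← b, ← a]
  rw [← sum_colorCount T c]
  push_cast
  rw [sum_mul, sum_congr rfl fun m _ => h1 m, ← mul_sum,
    card_eq_sum_card_fiberwise (f := fun d : ι → K => d i) (t := T.image c)]
  · push_cast; rfl
  · exact fun d hd => apply_mem_image hd hi

/-- The entropy of the color of one site is controlled by the energy of the swaps moving it. -/
lemma site_marginal_le {Ψ : ℝ → ℝ → ℝ} (hΨ : ConvexCost Ψ) {T : Finset ι} {i : ι} (hi : i ∈ T)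
    (c : ι → K) {g : (ι → K) → ℝ} (hg : ∀ c, 0 < g c) {A : ℝ} (hA0 : 0 ≤ A)
    (hA : ∀ x : K → ℝ, (∀ ℓ ∈ T.image c, 0 < x ℓ) →
      ∑ ℓ ∈ T.image c, (colorCount T c ℓ / T.card : ℝ) * (x ℓ * log (x ℓ)) -
        (∑ ℓ ∈ T.image c, (colorCount T c ℓ / T.card : ℝ) * x ℓ) *
          log (∑ ℓ ∈ T.image c, (colorCount T c ℓ / T.card : ℝ) * x ℓ) ≤
      A / 2 * ∑ ℓ ∈ T.image c, ∑ m ∈ T.image c,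
        (colorCount T c ℓ / T.card : ℝ) * (colorCount T c m / T.card : ℝ) * Ψ (x ℓ) (x m)) :
    ∑ ℓ ∈ T.image c, (∑ d ∈ (colorOrbit T c).filter fun d => d i = ℓ, g d) *
        log ((∑ d ∈ (colorOrbit T c).filter fun d => d i = ℓ, g d) /
          ((colorOrbit T c).filter fun d => d i = ℓ).card) -
      (∑ d ∈ colorOrbit T c, g d) * log ((∑ d ∈ colorOrbit T c, g d) / (colorOrbit T c).card) ≤
    A / (2 * T.card) * ∑ d ∈ colorOrbit T c, ∑ j ∈ T, Ψ (g d) (g (d ∘ Equiv.swap i j)) := by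
  set S := colorOrbit T c with hS
  set 𝒦 := T.image c with h𝒦
  set N : ℝ := ((T.card : ℕ) : ℝ) with hN
  have hNpos : 0 < N := by
    have : 0 < T.card := card_pos.2 ⟨i, hi⟩
    simpa [hN] using this
  have hSpos : (0 : ℝ) < S.card := by
    have : 0 < S.card := card_pos.2 ⟨c, self_mem_colorOrbit T c⟩
    simpa using this
  have hκ : ∀ ℓ ∈ 𝒦, (0 : ℝ) < colorCount T c ℓ := fun ℓ h => by
    exact_mod_cast colorCount_pos h
  set G : K → ℝ := fun ℓ => ∑ d ∈ S.filter (fun d => d i = ℓ), g d with hG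
  set n : K → ℝ := fun ℓ => ((S.filter fun d => d i = ℓ).card : ℝ) with hn
  have hNn : ∀ ℓ, N * n ℓ = colorCount T c ℓ * S.card := fun ℓ => card_mul_card_filter hi c ℓ
  have hn_pos : ∀ ℓ ∈ 𝒦, 0 < n ℓ := fun ℓ hl => by
    have : 0 < N * n ℓ := by rw [hNn]; exact mul_pos (hκ ℓ hl) hSpos
    exact (pos_iff_pos_of_mul_pos this).1 hNpos
  have hne : ∀ ℓ ∈ 𝒦, (S.filter fun d => d i = ℓ).Nonempty := fun ℓ hl => by
    have := hn_pos ℓ hl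
    simp only [hn] at this
    exact card_pos.1 (by exact_mod_cast this)
  have hG_pos : ∀ ℓ ∈ 𝒦, 0 < G ℓ := fun ℓ hl => sum_pos (fun d _ => hg d) (hne ℓ hl)
  have hGsum : ∑ d ∈ S, g d = ∑ ℓ ∈ 𝒦, G ℓ :=
    (sum_fiberwise_of_maps_to (fun d hd => apply_mem_image hd hi) g).symm
  have hx := hA (fun ℓ => G ℓ / n ℓ) fun ℓ hl => div_pos (hG_pos ℓ hl) (hn_pos ℓ hl)
  have hπ : ∀ ℓ ∈ 𝒦, (colorCount T c ℓ / N : ℝ) * (G ℓ / n ℓ) = G ℓ / S.card := by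
    intro ℓ hl
    have := hNn ℓ
    have h2 := (hn_pos ℓ hl).ne'
    field_simp
    linear_combination -(G ℓ) * this
  have h1 : ∑ ℓ ∈ 𝒦, (colorCount T c ℓ / N : ℝ) * (G ℓ / n ℓ) = (∑ d ∈ S, g d) / S.card := by
    rw [sum_congr rfl hπ, hGsum, sum_div]
  have h2 : ∑ ℓ ∈ 𝒦, (colorCount T c ℓ / N : ℝ) * (G ℓ / n ℓ * log (G ℓ / n ℓ)) =
      (∑ ℓ ∈ 𝒦, G ℓ * log (G ℓ / n ℓ)) / S.card := by
    rw [sum_div]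
    refine sum_congr rfl fun ℓ hl => ?_
    rw [← mul_assoc, hπ ℓ hl]; ring
  have h3 : ∀ ℓ ∈ 𝒦, ∀ m ∈ 𝒦,
      (colorCount T c ℓ / N : ℝ) * (colorCount T c m / N : ℝ) * Ψ (G ℓ / n ℓ) (G m / n m) ≤
      (1 / (N * S.card)) * ∑ p ∈ (S ×ˢ T).filter (fun p => p.1 i = ℓ ∧ p.1 p.2 = m),
        Ψ (g p.1) (g (p.1 ∘ Equiv.swap i p.2)) := by
    intro ℓ hl m hm
    have a := sum_color_const (T := T) (i := i) c ℓ m g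
    have b := sum_swap_color hi c ℓ m g
    have hPne : ((S ×ˢ T).filter (fun p => p.1 i = ℓ ∧ p.1 p.2 = m)).Nonempty := by
      by_contra hempty
      rw [not_nonempty_iff_eq_empty] at hempty
      rw [← hS, hempty, sum_empty] at a
      have := mul_pos (hκ m hm) (hG_pos ℓ hl)
      simp only [hG] at this
      linarith
    have key := hΨ.sum_le hPne (u := fun p => g p.1) (v := fun p => g (p.1 ∘ Equiv.swap i p.2))
      (fun _ _ => hg _) (fun _ _ => hg _)
    rw [← hS] at a b
    rw [a, b] at key
    have e1 : (colorCount T c m : ℝ) * G ℓ =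
        (colorCount T c ℓ * colorCount T c m * S.card / N) * (G ℓ / n ℓ) := by
      have := hNn ℓ
      have h2 := (hn_pos ℓ hl).ne'
      field_simp
      linear_combination (colorCount T c m * G ℓ : ℝ) * this
    have e2 : (colorCount T c ℓ : ℝ) * G m =
        (colorCount T c ℓ * colorCount T c m * S.card / N) * (G m / n m) := by
      have := hNn m
      have h2 := (hn_pos m hm).ne'
      field_simp
      linear_combination (colorCount T c ℓ * G m : ℝ) * this
    have h4 : Ψ (colorCount T c m * G ℓ) (colorCount T c ℓ * G m) =
        (colorCount T c ℓ * colorCount T c m * S.card / N) * Ψ (G ℓ / n ℓ) (G m / n m) := by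
      rw [e1, e2]
      exact hΨ.smul _ _ _ (div_pos (mul_pos (mul_pos (hκ ℓ hl) (hκ m hm)) hSpos) hNpos)
        (div_pos (hG_pos ℓ hl) (hn_pos ℓ hl)) (div_pos (hG_pos m hm) (hn_pos m hm))
    rw [show (colorCount T c ℓ / N : ℝ) * (colorCount T c m / N : ℝ) * Ψ (G ℓ / n ℓ) (G m / n m)
      = (1 / (N * S.card)) * ((colorCount T c ℓ * colorCount T c m * S.card / N) *
          Ψ (G ℓ / n ℓ) (G m / n m)) by field_simp, ← h4]
    exact mul_le_mul_of_nonneg_left key (by positivity)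
  have h4 : ∑ ℓ ∈ 𝒦, ∑ m ∈ 𝒦, ∑ p ∈ (S ×ˢ T).filter (fun p => p.1 i = ℓ ∧ p.1 p.2 = m),
        Ψ (g p.1) (g (p.1 ∘ Equiv.swap i p.2)) =
      ∑ d ∈ S, ∑ j ∈ T, Ψ (g d) (g (d ∘ Equiv.swap i j)) := by
    rw [← sum_product', ← sum_product']
    rw [← sum_fiberwise_of_maps_to (s := S ×ˢ T) (t := 𝒦 ×ˢ 𝒦)
      (g := fun p => (p.1 i, p.1 p.2))]
    · refine sum_congr rfl fun q _ => sum_congr ?_ fun _ _ => rfl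
      refine filter_congr fun p _ => ?_
      rw [Prod.ext_iff]
    · intro p hp
      rw [mem_product] at hp
      exact mem_product.2 ⟨apply_mem_image hp.1 hi, apply_mem_image hp.1 hp.2⟩
  rw [h1, h2] at hx
  have h5 : ∑ ℓ ∈ 𝒦, ∑ m ∈ 𝒦, (colorCount T c ℓ / N : ℝ) * (colorCount T c m / N : ℝ) *
      Ψ (G ℓ / n ℓ) (G m / n m) ≤
      (1 / (N * S.card)) * ∑ d ∈ S, ∑ j ∈ T, Ψ (g d) (g (d ∘ Equiv.swap i j)) := by
    rw [← h4, mul_sum]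
    refine sum_le_sum fun ℓ hl => ?_
    rw [mul_sum]
    exact sum_le_sum fun m hm => h3 ℓ hl m hm
  have h6 := hx.trans (mul_le_mul_of_nonneg_left h5 (by positivity))
  have h7 := mul_le_mul_of_nonneg_left h6 hSpos.le
  have e1 : (S.card : ℝ) * ((∑ ℓ ∈ 𝒦, G ℓ * log (G ℓ / n ℓ)) / S.card -
      (∑ d ∈ S, g d) / S.card * log ((∑ d ∈ S, g d) / S.card)) =
      ∑ ℓ ∈ 𝒦, G ℓ * log (G ℓ / n ℓ) - (∑ d ∈ S, g d) * log ((∑ d ∈ S, g d) / S.card) := by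
    field_simp
  have e2 : (S.card : ℝ) * (A / 2 * (1 / (N * S.card) *
      ∑ d ∈ S, ∑ j ∈ T, Ψ (g d) (g (d ∘ Equiv.swap i j)))) =
      A / (2 * N) * ∑ d ∈ S, ∑ j ∈ T, Ψ (g d) (g (d ∘ Equiv.swap i j)) := by
    field_simp
  rw [e1, e2] at h7
  exact h7

/-- Conditioning on the color of a uniformly chosen site. -/
lemma site_recursion {Ψ : ℝ → ℝ → ℝ} (hΨ : ConvexCost Ψ) {T : Finset ι}
    (c : ι → K) {g : (ι → K) → ℝ} (hg : ∀ c, 0 < g c) {A W : ℝ} (hA0 : 0 ≤ A)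
    (hA : ∀ x : K → ℝ, (∀ ℓ ∈ T.image c, 0 < x ℓ) →
      ∑ ℓ ∈ T.image c, (colorCount T c ℓ / T.card : ℝ) * (x ℓ * log (x ℓ)) -
        (∑ ℓ ∈ T.image c, (colorCount T c ℓ / T.card : ℝ) * x ℓ) *
          log (∑ ℓ ∈ T.image c, (colorCount T c ℓ / T.card : ℝ) * x ℓ) ≤
      A / 2 * ∑ ℓ ∈ T.image c, ∑ m ∈ T.image c,
        (colorCount T c ℓ / T.card : ℝ) * (colorCount T c m / T.card : ℝ) * Ψ (x ℓ) (x m))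
    (w : K → ℝ)
    (hw : ∀ i ∈ T, ∀ d ∈ colorOrbit T c, entSum (colorOrbit (T.erase i) d) g ≤
      w (d i) * ∑ e ∈ colorOrbit (T.erase i) d, swapEnergy Ψ (T.erase i) g e)
    (hW : ∀ d ∈ colorOrbit T c, ∀ j ∈ T, ∀ k ∈ T, d j ≠ d k →
      ∑ i ∈ (T.erase j).erase k, w (d i) ≤ W) :
    T.card * entSum (colorOrbit T c) g ≤
      (W + A / (2 * T.card)) * ∑ d ∈ colorOrbit T c, swapEnergy Ψ T g d := by
  have h1 : ∀ i ∈ T, entSum (colorOrbit T c) g ≤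
      ∑ d ∈ colorOrbit T c, w (d i) * swapEnergy Ψ (T.erase i) g d +
        A / (2 * T.card) * ∑ d ∈ colorOrbit T c, ∑ j ∈ T, Ψ (g d) (g (d ∘ Equiv.swap i j)) := by
    intro i hi
    rw [entSum_fiberwise (colorOrbit T c) g (fun d => d i) (T.image c)
      fun d hd => apply_mem_image hd hi]
    refine add_le_add ?_ (site_marginal_le hΨ hi c hg hA0 hA)
    rw [← sum_fiberwise_of_maps_to (g := fun d : ι → K => d i) (t := T.image c)
      fun d hd => apply_mem_image hd hi]
    refine sum_le_sum fun ℓ _ => ?_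
    rcases ((colorOrbit T c).filter fun d => d i = ℓ).eq_empty_or_nonempty with h | ⟨d, hd⟩
    · rw [h]; simp [entSum]
    · obtain ⟨hd1, rfl⟩ := mem_filter.1 hd
      have heq := filter_colorOrbit_apply_eq hi hd1
      rw [sum_congr rfl fun e he => by rw [(mem_filter.1 he).2], ← mul_sum, heq]
      exact hw i hi d hd1
  have h2 : ∀ d ∈ colorOrbit T c, ∑ i ∈ T, w (d i) * swapEnergy Ψ (T.erase i) g d ≤
      W * swapEnergy Ψ T g d := by
    intro d hd
    have e1 : ∑ i ∈ T, w (d i) * swapEnergy Ψ (T.erase i) g d =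
        ∑ j ∈ T, ∑ k ∈ T, (∑ i ∈ (T.erase j).erase k, w (d i)) *
          Ψ (g d) (g (d ∘ Equiv.swap j k)) := by
      have : ∀ i ∈ T, w (d i) * swapEnergy Ψ (T.erase i) g d = ∑ j ∈ T, ∑ k ∈ T,
          if i ≠ j ∧ i ≠ k then w (d i) * Ψ (g d) (g (d ∘ Equiv.swap j k)) else 0 := by
        intro i hi
        have he : T.erase i = T.filter fun j => i ≠ j := by
          ext j; simp [and_comm, eq_comm]
        rw [swapEnergy, mul_sum, he, sum_filter]
        refine sum_congr rfl fun j _ => ?_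
        by_cases hj : i ≠ j
        · rw [if_pos hj, mul_sum, sum_filter]
          simp [hj]
        · simp [hj]
      rw [sum_congr rfl this, sum_comm]
      refine sum_congr rfl fun j _ => ?_
      rw [sum_comm]
      refine sum_congr rfl fun k _ => ?_
      have he : (T.erase j).erase k = T.filter fun i => i ≠ j ∧ i ≠ k := by
        ext i; simp only [mem_erase, mem_filter]; tauto
      rw [he, sum_mul, sum_filter]
    rw [e1, swapEnergy, mul_sum]
    refine sum_le_sum fun j hj => ?_
    rw [mul_sum]
    refine sum_le_sum fun k hk => ?_
    by_cases hjk : d j = d k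
    · rw [comp_swap_of_eq hjk, hΨ.self]; simp
    · exact mul_le_mul_of_nonneg_right (hW d hd j hj k hk hjk) (hΨ.nonneg _ _ (hg _) (hg _))
  have h3 := sum_le_sum h1
  rw [sum_const, nsmul_eq_mul, sum_add_distrib, sum_comm, ← mul_sum, sum_comm (s := T)] at h3
  refine h3.trans ?_
  rw [add_mul]
  exact add_le_add ((sum_le_sum h2).trans_eq (mul_sum _ _ _).symm) le_rfl

end Colorings

lemma entropy_le_covariance {α : Type*} (s : Finset α) (w x : α → ℝ) (hw : ∀ a ∈ s, 0 ≤ w a)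
    (h1 : ∑ a ∈ s, w a = 1) (hx : ∀ a ∈ s, 0 < x a) :
    ∑ a ∈ s, w a * (x a * log (x a)) - (∑ a ∈ s, w a * x a) * log (∑ a ∈ s, w a * x a) ≤
      1 / 2 * ∑ a ∈ s, ∑ b ∈ s, w a * w b * ((x a - x b) * (log (x a) - log (x b))) := by
  have hJ : ∑ a ∈ s, w a * log (x a) ≤ log (∑ a ∈ s, w a * x a) := by
    have := strictConcaveOn_log_Ioi.concaveOn.le_map_sum hw h1 (p := x) fun a ha => hx a ha
    simpa using this
  have hM : 0 ≤ ∑ a ∈ s, w a * x a := sum_nonneg fun a ha => mul_nonneg (hw a ha) (hx a ha).le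
  have e : ∑ a ∈ s, ∑ b ∈ s, w a * w b * ((x a - x b) * (log (x a) - log (x b))) =
      2 * (∑ a ∈ s, w a * (x a * log (x a))) -
        2 * ((∑ a ∈ s, w a * x a) * ∑ a ∈ s, w a * log (x a)) := by
    have h : ∀ a b, w a * w b * ((x a - x b) * (log (x a) - log (x b))) =
        w a * (x a * log (x a)) * w b + w a * (w b * (x b * log (x b))) -
          w a * x a * (w b * log (x b)) - w a * log (x a) * (w b * x b) := fun a b => by ring
    simp only [h, sum_sub_distrib, sum_add_distrib, ← mul_sum, ← sum_mul, h1]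
    ring
  rw [e]
  nlinarith [mul_le_mul_of_nonneg_left hJ hM]

lemma nonpos_of_deriv_nonpos {f f' : ℝ → ℝ} (h0 : f 0 = 0)
    (hf : ∀ s ∈ Set.Icc (0 : ℝ) 1, HasDerivAt f (f' s) s)
    (hf' : ∀ s ∈ Set.Icc (0 : ℝ) 1, f' s ≤ 0) : ∀ s ∈ Set.Icc (0 : ℝ) 1, f s ≤ 0 := by
  have hanti : AntitoneOn f (Set.Icc 0 1) := by
    refine antitoneOn_of_deriv_nonpos (convex_Icc 0 1)
      (fun s hs => (hf s hs).continuousAt.continuousWithinAt) ?_ ?_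
    · intro s hs
      exact (hf s (interior_subset hs)).differentiableAt.differentiableWithinAt
    · intro s hs
      rw [(hf s (interior_subset hs)).deriv]
      exact hf' s (interior_subset hs)
  intro s hs
  rw [← h0]
  exact hanti ⟨le_rfl, zero_le_one⟩ hs hs.1

/-- The two-point entropy bound for values on the line `P u + Q v = P + Q`. -/
lemma two_point_line {P Q x : ℝ} (hP : 0 < P) (hQ : 0 < Q) (hu : 0 < 1 + Q * x)
    (hv : 0 < 1 - P * x) :
    P ^ 2 * (2 * (1 + Q * x) ^ 2 * log (1 + Q * x) - (1 + Q * x) ^ 2 + 1) +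
      Q ^ 2 * (2 * (1 - P * x) ^ 2 * log (1 - P * x) - (1 - P * x) ^ 2 + 1) ≤
    P ^ 2 * Q ^ 2 * x ^ 2 * (4 + 2 * log ((P + Q) ^ 2 / (4 * (P * Q)))) := by
  set Λ := 4 + 2 * log ((P + Q) ^ 2 / (4 * (P * Q))) with hΛ
  have pos : ∀ α : ℝ, 0 < 1 + α → ∀ s ∈ Set.Icc (0 : ℝ) 1, 0 < 1 + s * α := by
    intro α hα s hs
    nlinarith [hs.1, hs.2, mul_nonneg hs.1 hα.le]
  have hu' := pos (Q * x) hu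
  have hv' := pos (-(P * x)) (by linarith)
  have lin : ∀ α s : ℝ, HasDerivAt (fun s => 1 + s * α) α s := by
    intro α s
    simpa using ((hasDerivAt_id s).mul_const α).const_add 1
  have d1 : ∀ α s : ℝ, 0 < 1 + s * α →
      HasDerivAt (fun s => 2 * (1 + s * α) ^ 2 * log (1 + s * α) - (1 + s * α) ^ 2 + 1)
        (4 * α * ((1 + s * α) * log (1 + s * α))) s := by
    intro α s h
    have := (((((lin α s).pow 2).const_mul 2).mul ((lin α s).log h.ne')).sub
      ((lin α s).pow 2)).add_const 1
    refine HasDerivAt.congr_deriv this ?_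
    have hne := h.ne'
    simp only [Pi.pow_apply]
    field_simp
    ring
  have d2 : ∀ α s : ℝ, 0 < 1 + s * α →
      HasDerivAt (fun s => 4 * α * ((1 + s * α) * log (1 + s * α)))
        (4 * α ^ 2 * (log (1 + s * α) + 1)) s := by
    intro α s h
    have := ((lin α s).mul ((lin α s).log h.ne')).const_mul (4 * α)
    refine HasDerivAt.congr_deriv this ?_
    rw [mul_div_cancel₀ _ h.ne']
    ring
  have second : ∀ s ∈ Set.Icc (0 : ℝ) 1,
      P ^ 2 * (4 * (Q * x) ^ 2 * (log (1 + s * (Q * x)) + 1)) +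
        Q ^ 2 * (4 * (-(P * x)) ^ 2 * (log (1 + s * (-(P * x))) + 1)) -
        P ^ 2 * Q ^ 2 * x ^ 2 * Λ * 2 ≤ 0 := by
    intro s hs
    have h1 := hu' s hs
    have h2 := hv' s hs
    have h3 : log (1 + s * (Q * x)) + log (1 + s * (-(P * x))) ≤
        log ((P + Q) ^ 2 / (4 * (P * Q))) := by
      rw [← log_mul h1.ne' h2.ne']
      refine log_le_log (mul_pos h1 h2) ?_
      rw [le_div_iff₀ (by positivity)]
      nlinarith [sq_nonneg (P * (1 + s * (Q * x)) - Q * (1 + s * (-(P * x))))]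
    have h4 : 0 ≤ P ^ 2 * Q ^ 2 * x ^ 2 := by positivity
    nlinarith [mul_le_mul_of_nonneg_left h3 h4]
  have first : ∀ s ∈ Set.Icc (0 : ℝ) 1,
      P ^ 2 * (4 * (Q * x) * ((1 + s * (Q * x)) * log (1 + s * (Q * x)))) +
        Q ^ 2 * (4 * (-(P * x)) * ((1 + s * (-(P * x))) * log (1 + s * (-(P * x))))) -
        P ^ 2 * Q ^ 2 * x ^ 2 * Λ * (2 * s) ≤ 0 := by
    refine nonpos_of_deriv_nonpos (by simp) ?_ second
    intro s hs
    refine (((d2 _ s (hu' s hs)).const_mul _).add ((d2 _ s (hv' s hs)).const_mul _)).sub ?_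
    simpa using ((hasDerivAt_id s).const_mul 2).const_mul (P ^ 2 * Q ^ 2 * x ^ 2 * Λ)
  have zeroth : ∀ s ∈ Set.Icc (0 : ℝ) 1,
      P ^ 2 * (2 * (1 + s * (Q * x)) ^ 2 * log (1 + s * (Q * x)) - (1 + s * (Q * x)) ^ 2 + 1) +
        Q ^ 2 * (2 * (1 + s * (-(P * x))) ^ 2 * log (1 + s * (-(P * x))) -
          (1 + s * (-(P * x))) ^ 2 + 1) - P ^ 2 * Q ^ 2 * x ^ 2 * Λ * s ^ 2 ≤ 0 := by
    refine nonpos_of_deriv_nonpos (by simp) ?_ first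
    intro s hs
    refine (((d1 _ s (hu' s hs)).const_mul _).add ((d1 _ s (hv' s hs)).const_mul _)).sub ?_
    simpa using ((hasDerivAt_pow 2 s).const_mul (P ^ 2 * Q ^ 2 * x ^ 2 * Λ))
  have := zeroth 1 ⟨zero_le_one, le_rfl⟩
  simp only [one_mul, one_pow, mul_one, ← sub_eq_add_neg] at this
  linarith

lemma two_point_sq {P Q a b : ℝ} (hP : 0 < P) (hQ : 0 < Q) (h1 : P ^ 2 + Q ^ 2 = 1)
    (ha : 0 < a) (hb : 0 < b) :
    P ^ 2 * (a ^ 2 * log (a ^ 2)) + Q ^ 2 * (b ^ 2 * log (b ^ 2)) -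
      (P ^ 2 * a ^ 2 + Q ^ 2 * b ^ 2) * log (P ^ 2 * a ^ 2 + Q ^ 2 * b ^ 2) ≤
    (4 + 2 * log ((P + Q) ^ 2 / (4 * (P * Q)))) / (P + Q) ^ 2 *
      (P ^ 2 * Q ^ 2 * (a - b) ^ 2) := by
  have hPQ : 0 < P + Q := by positivity
  set t := (P * a + Q * b) / (P + Q) with ht
  have htpos : 0 < t := by positivity
  have htm : t * (P + Q) = P * a + Q * b := by rw [ht]; field_simp
  set x := (a - b) / ((P + Q) * t) with hx
  have hu : 1 + Q * x = a / t := by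
    rw [hx]; field_simp; linear_combination htm
  have hv : 1 - P * x = b / t := by
    rw [hx]; field_simp; linear_combination htm
  have key := two_point_line (x := x) hP hQ (by rw [hu]; positivity) (by rw [hv]; positivity)
  rw [hu, hv, log_div ha.ne' htpos.ne', log_div hb.ne' htpos.ne'] at key
  set M := P ^ 2 * a ^ 2 + Q ^ 2 * b ^ 2 with hM
  have hMpos : 0 < M := by positivity
  have hlog : M - t ^ 2 ≤ M * (log M - 2 * log t) := by
    have h := one_sub_inv_le_log_of_pos (x := M / t ^ 2) (by positivity)
    rw [log_div hMpos.ne' (by positivity), log_pow] at h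
    have := mul_le_mul_of_nonneg_left h hMpos.le
    have e : M * (1 - (M / t ^ 2)⁻¹) = M - t ^ 2 := by field_simp
    rw [e] at this
    exact_mod_cast this
  have key2 := mul_le_mul_of_nonneg_left key (sq_nonneg t)
  have e1 : t ^ 2 * (P ^ 2 * (2 * (a / t) ^ 2 * (log a - log t) - (a / t) ^ 2 + 1) +
      Q ^ 2 * (2 * (b / t) ^ 2 * (log b - log t) - (b / t) ^ 2 + 1)) =
      P ^ 2 * (a ^ 2 * (2 * log a)) + Q ^ 2 * (b ^ 2 * (2 * log b)) - M * (2 * log t) - M +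
        t ^ 2 := by
    rw [hM]
    field_simp
    linear_combination t ^ 2 * h1
  have e2 : t ^ 2 * (P ^ 2 * Q ^ 2 * x ^ 2 * (4 + 2 * log ((P + Q) ^ 2 / (4 * (P * Q))))) =
      (4 + 2 * log ((P + Q) ^ 2 / (4 * (P * Q)))) / (P + Q) ^ 2 *
        (P ^ 2 * Q ^ 2 * (a - b) ^ 2) := by
    rw [hx]
    field_simp
  rw [e1, e2] at key2
  have l1 : log (a ^ 2) = 2 * log a := by rw [log_pow]; norm_num
  have l2 : log (b ^ 2) = 2 * log b := by rw [log_pow]; norm_num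
  rw [l1, l2]
  linarith

lemma log_ratio_bound {v : ℝ} (hv : 0 < v) (hv1 : v ≤ 1) :
    (4 + 2 * log ((1 + v) / (2 * v))) / (1 + v) ≤ -2 * log (v / 2) / log 2 := by
  have l2 : 0 < log 2 := log_pos (by norm_num)
  have l2' : log 2 < 0.7 := by linarith [log_two_lt_d9]
  set ℓ := -log v with hℓ
  have h1 : log ((1 + v) / (2 * v)) ≤ (v - 1) / 2 + ℓ := by
    have e : (1 + v) / (2 * v) = (1 + v) / 2 / v := by field_simp
    rw [e, log_div (by positivity) hv.ne']
    have := log_le_sub_one_of_pos (x := (1 + v) / 2) (by positivity)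
    linarith
  have h2 : 2 * (1 - v) / (1 + v) ≤ ℓ := by
    have h := le_log_one_add_of_nonneg (x := (1 - v) / v) (div_nonneg (by linarith) hv.le)
    have e1 : 1 + (1 - v) / v = v⁻¹ := by field_simp; ring
    have e2 : 2 * ((1 - v) / v) / ((1 - v) / v + 2) = 2 * (1 - v) / (1 + v) := by
      have e3 : (1 - v) / v + 2 = (1 + v) / v := by field_simp; ring
      rw [e3]
      field_simp
    rw [e1, e2, log_inv] at h
    exact h
  have hℓ0 : 0 ≤ ℓ := by rw [hℓ]; linarith [log_nonpos hv.le hv1]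
  rw [log_div hv.ne' (by norm_num), div_le_div_iff₀ (by positivity) l2]
  have e : -2 * (log v - log 2) = 2 * ℓ + 2 * log 2 := by rw [hℓ]; ring
  rw [e]
  have h3 : 2 * (1 - v) ≤ ℓ * (1 + v) := by rwa [div_le_iff₀ (by positivity)] at h2
  have h4 : (4 + 2 * log ((1 + v) / (2 * v))) * log 2 ≤
      (4 + 2 * ((v - 1) / 2 + ℓ)) * log 2 :=
    mul_le_mul_of_nonneg_right (by linarith) l2.le
  refine h4.trans ?_
  have h5 : 0 ≤ (1 - log 2) * (ℓ * (1 + v) - 2 * (1 - v)) :=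
    mul_nonneg (by linarith) (by linarith)
  have h6 : 0 ≤ ℓ * v := mul_nonneg hℓ0 hv.le
  nlinarith [mul_nonneg (sub_nonneg.2 hv1) (sub_nonneg.2 l2'.le), mul_nonneg h6 l2.le]

/-- Two-point logarithmic Sobolev inequality. -/
lemma two_point_logSobolev {p q x y : ℝ} (hp : 0 < p) (hq : 0 < q) (h1 : p + q = 1)
    (hx : 0 < x) (hy : 0 < y) :
    p * (x * log x) + q * (y * log y) - (p * x + q * y) * log (p * x + q * y) ≤
      (-log p - log q) / log 2 * (p * q * (√x - √y) ^ 2) := by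
  have hP := sqrt_pos.2 hp
  have hQ := sqrt_pos.2 hq
  have eP := sq_sqrt hp.le
  have eQ := sq_sqrt hq.le
  have h := two_point_sq hP hQ (by rw [eP, eQ, h1]) (sqrt_pos.2 hx) (sqrt_pos.2 hy)
  have key := log_ratio_bound (v := 2 * (√p * √q)) (by positivity)
    (by nlinarith [sq_nonneg (√p - √q)])
  have e1 : (√p + √q) ^ 2 = 1 + 2 * (√p * √q) := by linear_combination eP + eQ + h1
  have e2 : -2 * log (2 * (√p * √q) / 2) = -log p - log q := by
    rw [mul_div_cancel_left₀ _ (two_ne_zero), log_mul hP.ne' hQ.ne', log_sqrt hp.le,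
      log_sqrt hq.le]
    ring
  rw [e2] at key
  rw [e1, eP, eQ, sq_sqrt hx.le, sq_sqrt hy.le,
    show 4 * (√p * √q) = 2 * (2 * (√p * √q)) by ring] at h
  exact h.trans (mul_le_mul_of_nonneg_right key (by positivity))

lemma mul_entropy_weight_le {p q R : ℝ} (hp : 0 < p) (hq : 0 < q) (h1 : p + q = 1)
    (hpR : 1 ≤ R * p) (hqR : 1 ≤ R * q) : q * (-log p - log q) ≤ log R := by
  have hR : 0 < R := by
    by_contra h
    nlinarith
  have lp : -log p ≤ log R := by
    have := log_nonneg hpR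
    rw [log_mul hR.ne' hp.ne'] at this
    linarith
  have lq : -log q ≤ log R := by
    have := log_nonneg hqR
    rw [log_mul hR.ne' hq.ne'] at this
    linarith
  have np : log p ≤ 0 := log_nonpos hp.le (by linarith)
  have nq : log q ≤ 0 := log_nonpos hq.le (by linarith)
  rcases le_total q p with h | h
  · have : log q ≤ log p := log_le_log hq h
    nlinarith
  · have hc : p / q * log p ≤ log q := by
      have := strictConcaveOn_log_Ioi.concaveOn.2 (show p ∈ Set.Ioi (0 : ℝ) from hp)
        (show (1 : ℝ) ∈ Set.Ioi (0 : ℝ) by simp) (show 0 ≤ p / q by positivity)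
        (show 0 ≤ 1 - p / q from sub_nonneg.2 (by rwa [div_le_one hq])) (by ring)
      simp only [smul_eq_mul, log_one, mul_zero, add_zero, mul_one] at this
      have e : p / q * p + (1 - p / q) = q := by
        field_simp
        have : q = 1 - p := by linarith
        rw [this]; ring
      rwa [e] at this
    have : p * log p ≤ q * log q := by
      have := mul_le_mul_of_nonneg_left hc hq.le
      rwa [← mul_assoc, mul_div_cancel₀ _ hq.ne'] at this
    nlinarith

lemma mul_log_succ_div_le (r : ℕ) :
    (r : ℝ) * (log (r + 1) - log r) ≤ 1 - 1 / (2 * (r + 1)) := by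
  rcases r.eq_zero_or_pos with rfl | hr
  · norm_num
  have hr' : (0 : ℝ) < r := by exact_mod_cast hr
  rw [← log_div (by positivity) hr'.ne']
  have h1 : (1 : ℝ) ≤ (r + 1) / r := by rw [le_div_iff₀ hr']; linarith
  have h2 : log (((r : ℝ) + 1) / r) ≤ sinh (log (((r : ℝ) + 1) / r)) :=
    self_le_sinh_iff.2 (log_nonneg h1)
  rw [sinh_log (by positivity)] at h2
  refine (mul_le_mul_of_nonneg_left h2 hr'.le).trans (le_of_eq ?_)
  field_simp
  ring

/-- The slice constant is superharmonic for the removal of a random site. -/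
lemma slice_constant_recursion (r s : ℕ) :
    r * (2 * log (r + s + 1) - log r - log (s + 1)) +
        s * (2 * log (r + s + 1) - log (r + 1) - log s) +
        (r + s + 1) / (r + s + 2) * (2 * log (r + s + 2) - log (r + 1) - log (s + 1)) ≤
      (r + s + 1 : ℝ) * (2 * log (r + s + 2) - log (r + 1) - log (s + 1)) := by
  set lam := 2 * log ((r : ℝ) + s + 2) - log (r + 1) - log (s + 1) with hlam
  suffices h : 0 ≤ lam / (r + s + 2) + 2 * (r + s) * (log (r + s + 2) - log (r + s + 1)) -
      r * (log (r + 1) - log r) - s * (log (s + 1) - log s) by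
    have e : ((r : ℝ) + s + 1) / (r + s + 2) = 1 - 1 / (r + s + 2) := by field_simp; ring
    rw [e]
    have : lam / (r + s + 2) = 1 / (r + s + 2) * lam := by ring
    rw [this] at h
    have e2 : (r : ℝ) * log (s + 1) + r * log (r + 1) + s * log (s + 1) + s * log (r + 1) =
      (r + s) * (log (r + 1) + log (s + 1)) := by ring
    nlinarith
  have l2 := log_two_gt_d9
  have l2' := log_two_lt_d9
  have hlam2 : 2 * log 2 ≤ lam := by
    have h : log (2 * 2 * ((r + 1) * (s + 1))) ≤ log (((r : ℝ) + s + 2) ^ 2) :=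
      log_le_log (by positivity) (by nlinarith [sq_nonneg ((r : ℝ) - s)])
    rw [log_mul (by positivity) (by positivity), log_mul (by positivity) (by positivity),
      log_mul (by positivity) (by positivity), log_pow] at h
    push_cast at h
    linarith
  have l3 : 13 * log 2 ≥ 8 * log 3 := by
    have h : log ((3 : ℝ) ^ 8) ≤ log (2 ^ 13) := log_le_log (by norm_num) (by norm_num)
    rw [log_pow, log_pow] at h
    push_cast at h; exact h
  have l3' : 10 * log 2 ≤ 8 * log 3 := by
    have h : log ((2 : ℝ) ^ 10) ≤ log (3 ^ 8) := log_le_log (by norm_num) (by norm_num)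
    rw [log_pow, log_pow] at h
    push_cast at h; exact h
  have l4 : log 4 = 2 * log 2 := by
    rw [show (4 : ℝ) = 2 ^ 2 by norm_num, log_pow]; norm_num
  rcases lt_or_ge (r + s) 3 with hsmall | hbig
  · have : (r = 0 ∧ s = 0) ∨ (r = 0 ∧ s = 1) ∨ (r = 0 ∧ s = 2) ∨ (r = 1 ∧ s = 0) ∨
        (r = 1 ∧ s = 1) ∨ (r = 2 ∧ s = 0) := by omega
    rcases this with ⟨rfl, rfl⟩ | ⟨rfl, rfl⟩ | ⟨rfl, rfl⟩ | ⟨rfl, rfl⟩ | ⟨rfl, rfl⟩ | ⟨rfl, rfl⟩ <;>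
      (rw [hlam]; norm_num [l4]; try linarith)
  · have hN : (3 : ℝ) ≤ r + s := by exact_mod_cast hbig
    have b1 := mul_log_succ_div_le r
    have b2 := mul_log_succ_div_le s
    have b3 : 2 / (2 * (r + s + 2) - 1) ≤ log ((r : ℝ) + s + 2) - log (r + s + 1) := by
      rw [← log_div (by positivity) (by positivity)]
      have h := le_log_one_add_of_nonneg (x := 1 / ((r : ℝ) + s + 1)) (by positivity)
      have e1 : 1 + 1 / ((r : ℝ) + s + 1) = (r + s + 2) / (r + s + 1) := by field_simp; ring
      have e2 : 2 * (1 / ((r : ℝ) + s + 1)) / (1 / (r + s + 1) + 2) =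
          2 / (2 * (r + s + 2) - 1) := by
        have : 2 * ((r : ℝ) + s + 2) - 1 ≠ 0 := by linarith
        have h2 : 1 + ((r : ℝ) + s + 1) * 2 ≠ 0 := by linarith
        field_simp
        ring
      rwa [e1, e2] at h
    have b4 : 2 / ((r : ℝ) + s + 2) ≤ 1 / (2 * (r + 1)) + 1 / (2 * (s + 1)) := by
      rw [div_add_div _ _ (by positivity) (by positivity), div_le_div_iff₀ (by positivity)
        (by positivity)]
      nlinarith [sq_nonneg ((r : ℝ) - s)]
    have b5 : 1.386 / ((r : ℝ) + s + 2) ≤ lam / (r + s + 2) := by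
      gcongr; linarith
    have b6 := mul_le_mul_of_nonneg_left b3 (by positivity : (0 : ℝ) ≤ 2 * (r + s))
    set n : ℝ := r + s with hn
    have b7 : 2 - 2 / (n + 2) - 1.386 / (n + 2) ≤ 2 * n * (2 / (2 * (n + 2) - 1)) := by
      have : 0 < 2 * (n + 2) - 1 := by linarith
      have e : 2 - 2 / (n + 2) - 1.386 / (n + 2) = (2 * n + 0.614) / (n + 2) := by
        field_simp; ring
      rw [e, mul_div_assoc', div_le_div_iff₀ (by linarith) this]
      nlinarith
    linarith

section Colorings

variable {ι K : Type*} [Fintype ι] [DecidableEq ι]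

lemma eq_of_mem_colorOrbit {T : Finset ι} {c d : ι → K} (h : (T.image c).card ≤ 1)
    (hd : d ∈ colorOrbit T c) : d = c := by
  ext i
  by_cases hi : i ∈ T
  · exact card_le_one.1 h _ (apply_mem_image hd hi) _ (mem_image_of_mem c hi)
  · exact (mem_colorOrbit_iff.1 hd).1 i hi

lemma sum_colorCount_div {T : Finset ι} (hT : T.Nonempty) (c : ι → K) :
    ∑ ℓ ∈ T.image c, (colorCount T c ℓ / T.card : ℝ) = 1 := by
  rw [← sum_div, ← Nat.cast_sum, sum_colorCount, div_self]
  exact_mod_cast hT.card_pos.ne'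

/-- Modified logarithmic Sobolev inequality for random transpositions on colorings. -/
lemma entSum_le_logEnergy {g : (ι → K) → ℝ} (hg : ∀ c, 0 < g c) (T : Finset ι) (c : ι → K) :
    entSum (colorOrbit T c) g ≤ 1 / (2 * T.card) *
      ∑ d ∈ colorOrbit T c, swapEnergy (fun x y => (x - y) * (log x - log y)) T g d := by
  induction hn : T.card generalizing T c with
  | zero =>
    rw [entSum_of_forall_eq fun d hd => eq_of_mem_colorOrbit (c := c) (d := d) (T := T) ?_ hd]
    · simp
    · exact card_image_le.trans (by omega)
  | succ n ih =>
    rcases le_or_gt (T.image c).card 1 with h | h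
    · rw [entSum_of_forall_eq fun d hd => eq_of_mem_colorOrbit h hd]
      exact mul_nonneg (by positivity)
        (sum_nonneg fun d _ => swapEnergy_nonneg convexCost_log T hg d)
    · have hn1 : 1 ≤ n := by
        have := (card_image_le (s := T) (f := c)); omega
      have hn1' : (1 : ℝ) ≤ n := by exact_mod_cast hn1
      have hT : T.Nonempty := card_pos.1 (by omega)
      have key := site_recursion convexCost_log c hg (A := 1) (T := T)
        (W := (n - 1 : ℝ) * (1 / (2 * n))) zero_le_one
        (fun x hx => entropy_le_covariance _ _ _ (fun _ _ => by positivity)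
          (sum_colorCount_div hT c) hx)
        (fun _ => 1 / (2 * n))
        (fun i hi d _ => ih _ _ (by rw [card_erase_of_mem hi, hn]; rfl))
        (by
          intro d _ j hj k hk hjk
          have hk' : k ∈ T.erase j := mem_erase.2 ⟨fun e => hjk (by rw [e]), hk⟩
          rw [sum_const, nsmul_eq_mul, card_erase_of_mem hk', card_erase_of_mem hj, hn]
          have : ((n + 1 - 1 - 1 : ℕ) : ℝ) = n - 1 := by
            rw [Nat.add_sub_cancel, Nat.cast_sub hn1]; simp
          rw [this])
      rw [hn] at key
      set E := ∑ d ∈ colorOrbit T c, swapEnergy (fun x y => (x - y) * (log x - log y)) T g d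
      have hE : 0 ≤ E := sum_nonneg fun d _ => swapEnergy_nonneg convexCost_log T hg d
      have hc : (n - 1 : ℝ) * (1 / (2 * n)) + 1 / (2 * ((n + 1 : ℕ) : ℝ)) ≤ 1 / 2 := by
        push_cast
        have e : (n - 1 : ℝ) * (1 / (2 * n)) = 1 / 2 - 1 / (2 * n) := by field_simp
        have : 1 / (2 * ((n : ℝ) + 1)) ≤ 1 / (2 * n) :=
          one_div_le_one_div_of_le (by positivity) (by linarith)
        linarith
      have h2 := key.trans (mul_le_mul_of_nonneg_right hc hE)
      have hpos : (0 : ℝ) < ((n + 1 : ℕ) : ℝ) := by positivity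
      rw [← mul_le_mul_iff_right₀ hpos]
      refine h2.trans_eq ?_
      field_simp

/-- The logarithmic Sobolev constant of a two-colored slice with color counts `r` and `s`. -/
def sliceConst (r s : ℕ) : ℝ := (2 * log (r + s) - log r - log s) / log 2

lemma sliceConst_nonneg (r s : ℕ) : 0 ≤ sliceConst r s := by
  have key : ∀ r s : ℕ, log (r : ℝ) ≤ log (r + s) := by
    intro r s
    rcases r.eq_zero_or_pos with rfl | h
    · simpa using log_natCast_nonneg s
    · exact log_le_log (by exact_mod_cast h) (by simp)
  have h1 := key r s
  have h2 := key s r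
  rw [add_comm] at h2
  exact div_nonneg (by linarith) (log_pos (by norm_num)).le

lemma colorCount_erase {T : Finset ι} {i : ι} (hi : i ∈ T) (c : ι → K) (ℓ : K) :
    colorCount (T.erase i) c ℓ + (if c i = ℓ then 1 else 0) = colorCount T c ℓ := by
  rw [← colorCount_sdiff (singleton_subset_iff.2 hi) c ℓ, sdiff_singleton_eq_erase]
  congr 1
  unfold colorCount
  rw [filter_singleton]
  split_ifs <;> rfl

/-- Logarithmic Sobolev inequality for two-colored configurations. -/
lemma entSum_le_sqrtEnergy_of_two_colors {u v : K} (huv : u ≠ v) {g : (ι → K) → ℝ}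
    (hg : ∀ c, 0 < g c) (T : Finset ι) (c : ι → K) (hc : ∀ i ∈ T, c i = u ∨ c i = v) :
    entSum (colorOrbit T c) g ≤ sliceConst (colorCount T c u) (colorCount T c v) / (2 * T.card) *
      ∑ d ∈ colorOrbit T c, swapEnergy (fun x y => (√x - √y) ^ 2) T g d := by
  induction hn : T.card using Nat.strong_induction_on generalizing T c with
  | _ n ih =>
  rcases le_or_gt (T.image c).card 1 with h | h
  · rw [entSum_of_forall_eq fun d hd => eq_of_mem_colorOrbit h hd]
    exact mul_nonneg (div_nonneg (sliceConst_nonneg _ _) (by positivity))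
      (sum_nonneg fun d _ => swapEnergy_nonneg convexCost_sqrt T hg d)
  have himg : T.image c = {u, v} := by
    refine eq_of_subset_of_card_le ?_ (card_le_two.trans h)
    intro ℓ hl
    obtain ⟨i, hi, rfl⟩ := mem_image.1 hl
    simpa using hc i hi
  have hcount : colorCount T c u + colorCount T c v = n := by
    rw [← hn, ← sum_colorCount T c, himg, sum_pair huv]
  obtain ⟨r, hr⟩ : ∃ r, colorCount T c u = r + 1 :=
    Nat.exists_eq_add_one.2 (colorCount_pos (by simp [himg]))
  obtain ⟨s, hs⟩ : ∃ s, colorCount T c v = s + 1 :=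
    Nat.exists_eq_add_one.2 (colorCount_pos (by simp [himg]))
  have hnrs : n = r + s + 2 := by omega
  subst hnrs
  have hcol : ∀ d ∈ colorOrbit T c, ∀ i ∈ T, d i = u ∨ d i = v := by
    intro d hd i hi
    have := apply_mem_image hd hi
    rw [himg] at this
    simpa using this
  have hN : ((T.card : ℕ) : ℝ) = r + s + 2 := by rw [hn]; push_cast; ring
  set a : ℝ := sliceConst r (s + 1) / (2 * ((r + s + 1 : ℕ) : ℝ)) with ha
  set b : ℝ := sliceConst (r + 1) s / (2 * ((r + s + 1 : ℕ) : ℝ)) with hb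
  have key := site_recursion convexCost_sqrt c hg (A := sliceConst (r + 1) (s + 1)) (T := T)
    (W := r * a + s * b) (sliceConst_nonneg _ _)
    (by
      intro x hx
      rw [himg] at hx ⊢
      simp only [sum_pair huv, hr, hs, hN]
      have hp : (0 : ℝ) < ((r + 1 : ℕ) : ℝ) / (r + s + 2) := by positivity
      have hq : (0 : ℝ) < ((s + 1 : ℕ) : ℝ) / (r + s + 2) := by positivity
      have h1 : ((r + 1 : ℕ) : ℝ) / (r + s + 2) + ((s + 1 : ℕ) : ℝ) / (r + s + 2) = 1 := by
        push_cast; field_simp; ring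
      have := two_point_logSobolev hp hq h1 (hx u (by simp)) (hx v (by simp))
      refine this.trans_eq ?_
      have e : -log (((r + 1 : ℕ) : ℝ) / (r + s + 2)) - log (((s + 1 : ℕ) : ℝ) / (r + s + 2)) =
          2 * log (((r + 1 : ℕ) : ℝ) + ((s + 1 : ℕ) : ℝ)) - log ((r + 1 : ℕ) : ℝ) -
            log ((s + 1 : ℕ) : ℝ) := by
        rw [log_div (by positivity) (by positivity), log_div (by positivity) (by positivity)]
        have : ((r + 1 : ℕ) : ℝ) + ((s + 1 : ℕ) : ℝ) = r + s + 2 := by push_cast; ring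
        rw [this]; ring
      rw [e]
      unfold sliceConst
      ring)
    (fun k => if k = u then a else b)
    (by
      intro i hi d hd
      have hcard : (T.erase i).card = r + s + 1 := by rw [card_erase_of_mem hi, hn]; rfl
      have := ih (r + s + 1) (by omega) (T.erase i) d
        (fun j hj => hcol d hd j (mem_of_mem_erase hj)) hcard
      have hu := colorCount_erase hi d u
      have hv := colorCount_erase hi d v
      rw [colorCount_eq_of_mem hd, hr] at hu
      rw [colorCount_eq_of_mem hd, hs] at hv
      rcases hcol d hd i hi with h | h
      · rw [if_pos h] at hu ⊢
        rw [if_neg (by rw [h]; exact huv)] at hv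
        rw [show colorCount (T.erase i) d u = r by omega,
          show colorCount (T.erase i) d v = s + 1 by omega] at this
        exact this
      · rw [if_pos h] at hv
        rw [if_neg (by rw [h]; exact huv.symm)] at hu ⊢
        rw [show colorCount (T.erase i) d u = r + 1 by omega,
          show colorCount (T.erase i) d v = s by omega] at this
        exact this)
    (by
      intro d hd j hj k hk hjk
      have hk' : k ∈ T.erase j := mem_erase.2 ⟨fun e => hjk (by rw [e]), hk⟩
      have hu1 := colorCount_erase hj d u
      have hv1 := colorCount_erase hj d v
      have hu2 := colorCount_erase hk' d u
      have hv2 := colorCount_erase hk' d v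
      rw [colorCount_eq_of_mem hd, hr] at hu1
      rw [colorCount_eq_of_mem hd, hs] at hv1
      have hvu := huv.symm
      have hu3 : colorCount ((T.erase j).erase k) d u = r := by
        rcases hcol d hd j hj with h | h <;> rcases hcol d hd k hk with h' | h' <;>
          simp_all
      have hv3 : colorCount ((T.erase j).erase k) d v = s := by
        rcases hcol d hd j hj with h | h <;> rcases hcol d hd k hk with h' | h' <;>
          simp_all
      rw [sum_ite, sum_const, sum_const, nsmul_eq_mul, nsmul_eq_mul]
      have hneg : ((T.erase j).erase k).filter (fun i => ¬ d i = u) =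
          ((T.erase j).erase k).filter (fun i => d i = v) := by
        refine filter_congr fun i hi => ?_
        rcases hcol d hd i (mem_of_mem_erase (mem_of_mem_erase hi)) with h | h
        · simp [h, huv]
        · simp [h, huv.symm]
      rw [hneg]
      unfold colorCount at hu3 hv3
      rw [hu3, hv3])
  rw [hN] at key
  rw [hr, hs]
  set E := ∑ d ∈ colorOrbit T c, swapEnergy (fun x y => (√x - √y) ^ 2) T g d
  have hE : 0 ≤ E := sum_nonneg fun d _ => swapEnergy_nonneg convexCost_sqrt T hg d
  have hcst : r * a + s * b + sliceConst (r + 1) (s + 1) / (2 * (r + s + 2)) ≤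
      sliceConst (r + 1) (s + 1) / 2 := by
    have h := slice_constant_recursion r s
    have l2 : 0 < log 2 := log_pos (by norm_num)
    have hM : (0 : ℝ) < r + s + 1 := by positivity
    have h' := div_le_div_of_nonneg_right h
      (by positivity : (0 : ℝ) ≤ 2 * (r + s + 1) * log 2)
    rw [ha, hb]
    unfold sliceConst
    push_cast
    rw [show (r : ℝ) + (s + 1) = r + s + 1 by ring, show (r : ℝ) + 1 + s = r + s + 1 by ring,
      show (r : ℝ) + 1 + (s + 1) = r + s + 2 by ring]
    refine le_of_eq_of_le ?_ (h'.trans_eq ?_)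
    · field_simp
    · field_simp
  have h2 := key.trans (mul_le_mul_of_nonneg_right hcst hE)
  have hpos : (0 : ℝ) < r + s + 2 := by positivity
  rw [← mul_le_mul_iff_right₀ hpos]
  refine h2.trans_eq ?_
  push_cast
  field_simp

/-- The indicator of the sites with color `ℓ`. -/
def colorLevel (ℓ : K) (c : ι → K) : ι → Bool := fun i => decide (c i = ℓ)

lemma colorLevel_mem {T : Finset ι} {c d : ι → K} (ℓ : K) (hd : d ∈ colorOrbit T c) :
    colorLevel ℓ d ∈ colorOrbit T (colorLevel ℓ c) := by
  obtain ⟨σ, hσ, rfl⟩ := mem_colorOrbit.1 hd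
  exact mem_colorOrbit.2 ⟨σ, hσ, rfl⟩

/-- The configurations of an orbit whose sites of color `ℓ` are prescribed. -/
def levelFiber (T : Finset ι) (c : ι → K) (ℓ : K) (β : ι → Bool) : Finset (ι → K) :=
  (colorOrbit T c).filter fun d => colorLevel ℓ d = β

lemma sum_levelFiber_comp_perm {T : Finset ι} (c : ι → K) (ℓ : K) (β : ι → Bool)
    {σ : Equiv.Perm ι} (hσ : ∀ i, i ∉ T → σ i = i) (F : (ι → K) → ℝ) :
    ∑ d ∈ levelFiber T c ℓ (β ∘ σ), F d = ∑ d ∈ levelFiber T c ℓ β, F (d ∘ σ) := by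
  have hσ' : ∀ i, i ∉ T → σ.symm i = i := fun i hi => by
    rw [Equiv.symm_apply_eq]; exact (hσ i hi).symm
  have e1 : ∀ d : ι → K, (d ∘ σ.symm) ∘ σ = d := fun d => by ext; simp
  have e2 : ∀ d : ι → K, (d ∘ σ) ∘ σ.symm = d := fun d => by ext; simp
  refine sum_nbij' (fun d => d ∘ σ.symm) (fun d => d ∘ σ) ?_ ?_ (fun d _ => e1 d)
    (fun d _ => e2 d) (fun d _ => by rw [e1])
  · intro d hd
    obtain ⟨h1, h2⟩ := mem_filter.1 hd
    refine mem_filter.2 ⟨comp_perm_mem_colorOrbit h1 hσ', ?_⟩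
    ext i
    have := congrFun h2 (σ.symm i)
    simp only [Function.comp, Equiv.apply_symm_apply] at this
    rw [← this]; rfl
  · intro d hd
    obtain ⟨h1, h2⟩ := mem_filter.1 hd
    exact mem_filter.2 ⟨comp_perm_mem_colorOrbit h1 hσ, by rw [← h2]; rfl⟩

lemma levelFiber_colorLevel {T : Finset ι} (ℓ : K) {c d : ι → K} (hd : d ∈ colorOrbit T c) :
    levelFiber T c ℓ (colorLevel ℓ d) = colorOrbit (T \ T.filter fun i => d i = ℓ) d := by
  rw [← filter_colorOrbit_level ℓ hd]
  unfold levelFiber colorLevel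
  congr

lemma levelFiber_nonempty {T : Finset ι} {c : ι → K} {ℓ : K} {β : ι → Bool}
    (hβ : β ∈ colorOrbit T (colorLevel ℓ c)) : (levelFiber T c ℓ β).Nonempty := by
  obtain ⟨σ, hσ, rfl⟩ := mem_colorOrbit.1 hβ
  exact ⟨c ∘ σ, mem_filter.2 ⟨comp_perm_mem_colorOrbit (self_mem_colorOrbit T c) hσ, rfl⟩⟩

lemma card_levelFiber {T : Finset ι} {c : ι → K} {ℓ : K} {β : ι → Bool}
    (hβ : β ∈ colorOrbit T (colorLevel ℓ c)) :
    (levelFiber T c ℓ β).card = (levelFiber T c ℓ (colorLevel ℓ c)).card := by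
  obtain ⟨σ, hσ, rfl⟩ := mem_colorOrbit.1 hβ
  have := sum_levelFiber_comp_perm c ℓ (colorLevel ℓ c) hσ fun _ => 1
  simpa using this

lemma colorCount_colorLevel_true (T : Finset ι) (c : ι → K) (ℓ : K) :
    colorCount T (colorLevel ℓ c) true = colorCount T c ℓ := by
  simp [colorCount, colorLevel]

lemma colorCount_colorLevel_false (T : Finset ι) (c : ι → K) (ℓ : K) :
    colorCount T (colorLevel ℓ c) false + colorCount T c ℓ = T.card := by
  simp only [colorCount, colorLevel, decide_eq_false_iff_not]
  rw [add_comm, card_filter_add_card_filter_not]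

lemma sum_sum_levelFiber (T : Finset ι) (c : ι → K) (ℓ : K) (p : (ι → Bool) → (ι → K) → ℝ) :
    ∑ β ∈ colorOrbit T (colorLevel ℓ c), ∑ d ∈ levelFiber T c ℓ β, p β d =
      ∑ d ∈ colorOrbit T c, p (colorLevel ℓ d) d := by
  rw [← sum_fiberwise_of_maps_to fun d hd => colorLevel_mem ℓ hd]
  refine sum_congr rfl fun β _ => ?_
  refine sum_congr (by unfold levelFiber; congr) fun d hd => ?_
  rw [(mem_filter.1 hd).2]

/-- The positions of the sites of color `ℓ` have entropy controlled by the swaps moving them. -/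
lemma level_marginal_le {g : (ι → K) → ℝ} (hg : ∀ c, 0 < g c) (T : Finset ι) (c : ι → K)
    (ℓ : K) :
    ∑ β ∈ colorOrbit T (colorLevel ℓ c), (∑ d ∈ levelFiber T c ℓ β, g d) *
        log ((∑ d ∈ levelFiber T c ℓ β, g d) / (levelFiber T c ℓ β).card) -
      (∑ d ∈ colorOrbit T c, g d) * log ((∑ d ∈ colorOrbit T c, g d) / (colorOrbit T c).card) ≤
    sliceConst (colorCount T (colorLevel ℓ c) true) (colorCount T (colorLevel ℓ c) false) /
        (2 * T.card) * ∑ d ∈ colorOrbit T c, ∑ i ∈ T, ∑ j ∈ T,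
          if colorLevel ℓ d i = colorLevel ℓ d j then 0
          else (√(g d) - √(g (d ∘ Equiv.swap i j))) ^ 2 := by
  set B := colorOrbit T (colorLevel ℓ c) with hB
  set S := colorOrbit T c with hS
  set n₀ := (levelFiber T c ℓ (colorLevel ℓ c)).card with hn₀
  set G : (ι → Bool) → ℝ := fun β => ∑ d ∈ levelFiber T c ℓ β, g d with hG
  set G' : (ι → Bool) → ℝ := fun β => if β ∈ B then G β else 1 with hG'
  have hGpos : ∀ β ∈ B, 0 < G β := fun β hβ => sum_pos (fun _ _ => hg _) (levelFiber_nonempty hβ)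
  have hG'pos : ∀ β, 0 < G' β := by
    intro β
    simp only [hG']
    split_ifs with h
    · exact hGpos β h
    · exact one_pos
  have hn₀pos : (0 : ℝ) < n₀ := by
    have := card_pos.2 (levelFiber_nonempty (self_mem_colorOrbit T (colorLevel ℓ c)))
    exact_mod_cast this
  have hGsum : ∑ d ∈ S, g d = ∑ β ∈ B, G β := (sum_sum_levelFiber T c ℓ fun _ d => g d).symm
  have hcard : (S.card : ℝ) = n₀ * B.card := by
    have := sum_sum_levelFiber T c ℓ fun _ _ => 1
    simp only [sum_const, nsmul_eq_mul, mul_one] at this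
    rw [hS, ← this, sum_congr rfl fun β hβ => by rw [card_levelFiber hβ]]
    simp [hB, hn₀, mul_comm]
  have hBpos : (0 : ℝ) < B.card := by
    have := card_pos.2 ⟨_, self_mem_colorOrbit T (colorLevel ℓ c)⟩
    exact_mod_cast this
  have hBne : B.Nonempty := ⟨_, self_mem_colorOrbit T (colorLevel ℓ c)⟩
  have hsum_pos : 0 < ∑ β ∈ B, G β := sum_pos hGpos hBne
  have hent : ∑ β ∈ B, G β * log (G β / (levelFiber T c ℓ β).card) -
      (∑ d ∈ S, g d) * log ((∑ d ∈ S, g d) / S.card) = entSum B G' := by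
    have h1 : ∀ β ∈ B, G β * log (G β / (levelFiber T c ℓ β).card) =
        G' β * log (G' β) - G β * log n₀ := by
      intro β hβ
      rw [card_levelFiber hβ, log_div (hGpos β hβ).ne' hn₀pos.ne']
      simp only [hG', if_pos hβ]
      ring
    have h2 : ∑ β ∈ B, G' β = ∑ β ∈ B, G β := sum_congr rfl fun β hβ => by simp [hG', hβ]
    rw [sum_congr rfl h1, hGsum, hcard, entSum, h2, sum_sub_distrib, ← sum_mul,
      log_div hsum_pos.ne' (by positivity), log_div hsum_pos.ne' hBpos.ne',
      log_mul hn₀pos.ne' hBpos.ne']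
    ring
  rw [hent]
  refine (entSum_le_sqrtEnergy_of_two_colors (u := true) (v := false) (by simp) hG'pos T
    (colorLevel ℓ c) (fun i _ => by cases colorLevel ℓ c i <;> simp)).trans ?_
  refine mul_le_mul_of_nonneg_left ?_ (div_nonneg (sliceConst_nonneg _ _) (by positivity))
  rw [hS, ← sum_sum_levelFiber T c ℓ fun β d => ∑ i ∈ T, ∑ j ∈ T, if β i = β j then 0
          else (√(g d) - √(g (d ∘ Equiv.swap i j))) ^ 2]
  refine sum_le_sum fun β hβ => ?_
  rw [sum_comm, swapEnergy]
  refine sum_le_sum fun i hi => ?_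
  rw [sum_comm]
  refine sum_le_sum fun j hj => ?_
  by_cases hij : β i = β j
  · rw [comp_swap_of_eq hij]
    simp [hij]
  · have h1 : G' β = ∑ d ∈ levelFiber T c ℓ β, g d := if_pos hβ
    have h2 : G' (β ∘ Equiv.swap i j) =
        ∑ d ∈ levelFiber T c ℓ β, g (d ∘ Equiv.swap i j) := by
      have := comp_perm_mem_colorOrbit hβ (swap_fixes hi hj)
      exact (if_pos this).trans (sum_levelFiber_comp_perm c ℓ β (swap_fixes hi hj) g)
    simp only [hij, if_false]
    rw [h1, h2]
    exact convexCost_sqrt.sum_le (levelFiber_nonempty hβ) (fun _ _ => hg _) fun _ _ => hg _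

/-- Conditioning on the positions of the sites of color `ℓ`. -/
lemma level_recursion {g : (ι → K) → ℝ} (hg : ∀ c, 0 < g c) (T : Finset ι) (c : ι → K)
    (ℓ : K) {w : ℝ}
    (hw : ∀ d ∈ colorOrbit T c, entSum (colorOrbit (T \ T.filter fun i => d i = ℓ) d) g ≤
      w * ∑ e ∈ colorOrbit (T \ T.filter fun i => d i = ℓ) d,
        swapEnergy (fun x y => (√x - √y) ^ 2) (T \ T.filter fun i => d i = ℓ) g e) :
    entSum (colorOrbit T c) g ≤
      w * ∑ d ∈ colorOrbit T c, ∑ i ∈ T, ∑ j ∈ T,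
        (if d i ≠ ℓ ∧ d j ≠ ℓ then (√(g d) - √(g (d ∘ Equiv.swap i j))) ^ 2 else 0) +
      sliceConst (colorCount T (colorLevel ℓ c) true) (colorCount T (colorLevel ℓ c) false) /
        (2 * T.card) * ∑ d ∈ colorOrbit T c, ∑ i ∈ T, ∑ j ∈ T,
          if colorLevel ℓ d i = colorLevel ℓ d j then 0
          else (√(g d) - √(g (d ∘ Equiv.swap i j))) ^ 2 := by
  have hchain : entSum (colorOrbit T c) g =
      ∑ β ∈ colorOrbit T (colorLevel ℓ c), entSum (levelFiber T c ℓ β) g +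
      (∑ β ∈ colorOrbit T (colorLevel ℓ c), (∑ d ∈ levelFiber T c ℓ β, g d) *
        log ((∑ d ∈ levelFiber T c ℓ β, g d) / (levelFiber T c ℓ β).card) -
      (∑ d ∈ colorOrbit T c, g d) *
        log ((∑ d ∈ colorOrbit T c, g d) / (colorOrbit T c).card)) := by
    convert entSum_fiberwise _ g (colorLevel ℓ) _ fun d hd => colorLevel_mem ℓ hd <;>
      (unfold levelFiber; congr)
  rw [hchain]
  refine add_le_add ?_ (level_marginal_le hg T c ℓ)
  rw [← sum_sum_levelFiber T c ℓ fun _ d => ∑ i ∈ T, ∑ j ∈ T,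
    if d i ≠ ℓ ∧ d j ≠ ℓ then (√(g d) - √(g (d ∘ Equiv.swap i j))) ^ 2 else 0, mul_sum]
  refine sum_le_sum fun β hβ => ?_
  obtain ⟨d, hd⟩ := levelFiber_nonempty hβ
  obtain ⟨hd1, rfl⟩ := mem_filter.1 hd
  have h := hw d hd1
  rw [← levelFiber_colorLevel ℓ hd1] at h
  refine h.trans_eq ?_
  congr 1
  refine sum_congr rfl fun e he => ?_
  have hlev := (mem_filter.1 he).2
  have hT : (T \ T.filter fun i => d i = ℓ) = T.filter fun i => e i ≠ ℓ := by
    ext i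
    have := congrFun hlev i
    simp only [colorLevel, decide_eq_decide] at this
    simp only [mem_sdiff, mem_filter, this, ne_eq]
    tauto
  rw [hT, swapEnergy, sum_filter]
  refine sum_congr rfl fun i _ => ?_
  by_cases hi : e i ≠ ℓ
  · simp [hi, sum_filter]
  · simp [hi]

lemma mul_slice_weight_le {k s N R : ℝ} (hk : 0 < k) (hs : 0 < s) (hN : 0 < N)
    (h : s / N * (-log (k / N) - log (s / N)) ≤ log R) :
    s * ((2 * log N - log k - log s) / log 2 / (2 * N)) ≤ log R / log 2 / 2 := by
  have l2 : 0 < log 2 := log_pos (by norm_num)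
  rw [log_div hk.ne' hN.ne', log_div hs.ne' hN.ne'] at h
  refine le_of_eq_of_le ?_ (div_le_div_of_nonneg_right
    (div_le_div_of_nonneg_right h l2.le) zero_le_two)
  ring

/-- Logarithmic Sobolev inequality for random transpositions on colorings. -/
lemma entSum_le_sqrtEnergy {R : ℝ} {g : (ι → K) → ℝ} (hg : ∀ c, 0 < g c) (T : Finset ι)
    (c : ι → K) (hR : ∀ ℓ ∈ T.image c, (T.card : ℝ) ≤ R * colorCount T c ℓ) :
    entSum (colorOrbit T c) g ≤ log R / log 2 / T.card *
      ∑ d ∈ colorOrbit T c, swapEnergy (fun x y => (√x - √y) ^ 2) T g d := by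
  induction hn : T.card using Nat.strong_induction_on generalizing T c with
  | _ n ih =>
  subst hn
  have hE : 0 ≤ ∑ d ∈ colorOrbit T c, swapEnergy (fun x y => (√x - √y) ^ 2) T g d :=
    sum_nonneg fun d _ => swapEnergy_nonneg convexCost_sqrt T hg d
  have l2 : 0 < log 2 := log_pos (by norm_num)
  rcases T.eq_empty_or_nonempty with rfl | hT
  · rw [entSum_of_forall_eq fun d hd => eq_of_mem_colorOrbit (by simp) hd]
    simp
  have hTpos : (0 : ℝ) < T.card := by exact_mod_cast hT.card_pos
  have hcnt : ∀ ℓ ∈ T.image c, (0 : ℝ) < colorCount T c ℓ := fun ℓ hl => by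
    exact_mod_cast colorCount_pos hl
  have hR1 : 1 ≤ R := by
    obtain ⟨i, hi⟩ := hT
    have hl := mem_image_of_mem c hi
    have h1 := hR _ hl
    have h2 : (colorCount T c (c i) : ℝ) ≤ T.card := by
      exact_mod_cast card_filter_le _ _
    have h3 := hcnt _ hl
    by_contra h
    nlinarith
  rcases le_or_gt (T.image c).card 1 with h | h
  · rw [entSum_of_forall_eq fun d hd => eq_of_mem_colorOrbit h hd]
    exact mul_nonneg (div_nonneg (div_nonneg (log_nonneg hR1) l2.le) hTpos.le) hE
  set C := log R / log 2 with hC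
  have step : ∀ ℓ ∈ T.image c, (T.card - colorCount T c ℓ : ℝ) * entSum (colorOrbit T c) g ≤
      ∑ d ∈ colorOrbit T c, ∑ i ∈ T, ∑ j ∈ T,
        C / 2 * (2 - (if d i = ℓ then 1 else 0) - (if d j = ℓ then 1 else 0)) *
          (√(g d) - √(g (d ∘ Equiv.swap i j))) ^ 2 := by
    intro ℓ hl
    have hfalse := colorCount_colorLevel_false T c ℓ
    obtain ⟨m, hm, hmℓ⟩ := exists_mem_ne h ℓ
    have hmle : colorCount T c m ≤ colorCount T (colorLevel ℓ c) false := by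
      unfold colorCount
      refine card_le_card fun i hi => ?_
      simp only [mem_filter] at hi ⊢
      exact ⟨hi.1, by simp [colorLevel, hi.2, hmℓ]⟩
    set s := colorCount T (colorLevel ℓ c) false with hs
    have hs_eq : (s : ℝ) = T.card - colorCount T c ℓ := by
      rw [← hfalse]; push_cast; ring
    have hspos : (0 : ℝ) < s := (hcnt m hm).trans_le (by exact_mod_cast hmle)
    have key := level_recursion hg T c ℓ (w := C / s) (by
      intro d hd
      have hcard : (T \ T.filter fun i => d i = ℓ).card = s := by
        have h1 := card_sdiff_add_card_eq_card (filter_subset (fun i => d i = ℓ) T)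
        have h2 : (T.filter fun i => d i = ℓ).card = colorCount T c ℓ := by
          rw [← colorCount_eq_of_mem hd]; rfl
        omega
      have := ih s (by have := colorCount_pos hl; omega) (T \ T.filter fun i => d i = ℓ) d (by
        intro k hk
        obtain ⟨i, hi, rfl⟩ := mem_image.1 hk
        obtain ⟨hi1, hi2⟩ := mem_sdiff.1 hi
        have hdi : d i ≠ ℓ := fun e => hi2 (mem_filter.2 ⟨hi1, e⟩)
        have h1 := colorCount_sdiff (filter_subset (fun i => d i = ℓ) T) d (d i)
        have h2 : colorCount (T.filter fun i => d i = ℓ) d (d i) = 0 := by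
          rw [colorCount, card_eq_zero, filter_eq_empty_iff]
          intro j hj e
          exact hdi (e ▸ (mem_filter.1 hj).2)
        have h3 := hR (d i) (apply_mem_image hd hi1)
        rw [← colorCount_eq_of_mem hd, ← h1, h2, add_zero] at h3
        refine le_trans ?_ h3
        exact_mod_cast card_le_card sdiff_subset) hcard
      exact this)
    rw [← hs_eq]
    have key2 := mul_le_mul_of_nonneg_left key hspos.le
    refine key2.trans ?_
    have hconst : (s : ℝ) * (sliceConst (colorCount T (colorLevel ℓ c) true) s / (2 * T.card)) ≤
        C / 2 := by
      rw [colorCount_colorLevel_true]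
      have hN : (T.card : ℝ) = colorCount T c ℓ + s := by rw [hs_eq]; ring
      have hκ := hcnt ℓ hl
      have := mul_entropy_weight_le (p := colorCount T c ℓ / T.card) (q := s / T.card) (R := R)
        (div_pos hκ hTpos) (div_pos hspos hTpos) (by rw [← add_div, ← hN, div_self hTpos.ne'])
        (by rw [mul_div_assoc', le_div_iff₀ hTpos, one_mul]; exact hR ℓ hl)
        (by
          rw [mul_div_assoc', le_div_iff₀ hTpos, one_mul]
          refine (hR m hm).trans (mul_le_mul_of_nonneg_left ?_ (by linarith))
          exact_mod_cast hmle)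
      unfold sliceConst
      rw [← hN]
      exact mul_slice_weight_le hκ hspos hTpos this
    have hY : 0 ≤ ∑ d ∈ colorOrbit T c, ∑ i ∈ T, ∑ j ∈ T,
          if colorLevel ℓ d i = colorLevel ℓ d j then 0
          else (√(g d) - √(g (d ∘ Equiv.swap i j))) ^ 2 :=
      sum_nonneg fun d _ => sum_nonneg fun i _ => sum_nonneg fun j _ => by
        split_ifs
        · exact le_rfl
        · exact sq_nonneg _
    rw [mul_add, ← mul_assoc, ← mul_assoc, mul_div_cancel₀ _ hspos.ne']
    refine (add_le_add_right (mul_le_mul_of_nonneg_right hconst hY) _).trans ?_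
    simp only [mul_sum, ← sum_add_distrib]
    refine sum_le_sum fun d hd => sum_le_sum fun i hi => sum_le_sum fun j hj => le_of_eq ?_
    by_cases hdi : d i = ℓ <;> by_cases hdj : d j = ℓ <;>
      simp only [colorLevel, hdi, hdj, ne_eq, not_true_eq_false, not_false_eq_true, and_true,
        and_false, and_self, if_true, if_false, decide_true, decide_false, reduceCtorEq] <;>
      ring
  have hsum := sum_le_sum step
  rw [← sum_mul, sum_sub_distrib, sum_const, nsmul_eq_mul, ← Nat.cast_sum, sum_colorCount,
    sum_comm] at hsum
  have hrhs : ∑ d ∈ colorOrbit T c, ∑ ℓ ∈ T.image c, ∑ i ∈ T, ∑ j ∈ T,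
        C / 2 * (2 - (if d i = ℓ then 1 else 0) - (if d j = ℓ then 1 else 0)) *
          (√(g d) - √(g (d ∘ Equiv.swap i j))) ^ 2 =
      C * ((T.image c).card - 1) *
        ∑ d ∈ colorOrbit T c, swapEnergy (fun x y => (√x - √y) ^ 2) T g d := by
    rw [mul_sum]
    refine sum_congr rfl fun d hd => ?_
    rw [sum_comm, swapEnergy, mul_sum]
    refine sum_congr rfl fun i hi => ?_
    rw [sum_comm, mul_sum]
    refine sum_congr rfl fun j hj => ?_
    rw [← sum_mul, ← mul_sum, sum_sub_distrib, sum_sub_distrib, sum_ite_eq, sum_ite_eq,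
      if_pos (apply_mem_image hd hi), if_pos (apply_mem_image hd hj), sum_const, nsmul_eq_mul]
    ring
  rw [hrhs] at hsum
  have hL : (0 : ℝ) < (T.image c).card - 1 := by
    have : (1 : ℝ) < (T.image c).card := by exact_mod_cast h
    linarith
  have hpos : 0 < ((T.image c).card - 1 : ℝ) * T.card := mul_pos hL hTpos
  rw [← mul_le_mul_iff_right₀ hpos]
  refine le_of_eq_of_le ?_ (hsum.trans_eq ?_)
  · ring
  · field_simp

/-- Logarithmic Sobolev inequality for the square of an arbitrary function. -/
lemma entSum_sq_le {R : ℝ} (F : (ι → K) → ℝ) (T : Finset ι)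
    (c : ι → K) (hR : ∀ ℓ ∈ T.image c, (T.card : ℝ) ≤ R * colorCount T c ℓ) (hR0 : 0 ≤ log R) :
    entSum (colorOrbit T c) (fun d => F d ^ 2) ≤ log R / log 2 / T.card *
      ∑ d ∈ colorOrbit T c, ∑ i ∈ T, ∑ j ∈ T, (F d - F (d ∘ Equiv.swap i j)) ^ 2 := by
  have hcont : Continuous fun ε : ℝ => entSum (colorOrbit T c) fun d => (|F d| + ε) ^ 2 := by
    have e : ∀ S : Finset (ι → K), 0 < S.card → ∀ g : (ι → K) → ℝ, entSum S g =
        ∑ ω ∈ S, g ω * log (g ω) -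
          S.card * ((∑ ω ∈ S, g ω) / S.card * log ((∑ ω ∈ S, g ω) / S.card)) := by
      intro S hS g
      have : (S.card : ℝ) ≠ 0 := by exact_mod_cast hS.ne'
      rw [entSum]; field_simp
    simp only [e _ (card_pos.2 ⟨c, self_mem_colorOrbit T c⟩)]
    refine Continuous.sub (continuous_finsetSum _ fun d _ => ?_) (continuous_const.mul ?_)
    · exact continuous_mul_log.comp (by fun_prop : Continuous fun ε : ℝ => (|F d| + ε) ^ 2)
    · exact continuous_mul_log.comp
        (by fun_prop : Continuous fun ε : ℝ =>
          (∑ d ∈ colorOrbit T c, (|F d| + ε) ^ 2) / ((colorOrbit T c).card : ℝ))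
  have hlim := (hcont.tendsto 0).mono_left (nhdsWithin_le_nhds (s := Set.Ioi 0))
  simp only [add_zero, sq_abs] at hlim
  refine le_of_tendsto hlim ?_
  filter_upwards [self_mem_nhdsWithin] with ε hε
  have hε' : 0 < ε := hε
  have hpos : ∀ d, 0 < |F d| + ε := fun d => by positivity
  refine (entSum_le_sqrtEnergy (g := fun d => (|F d| + ε) ^ 2) (fun d => by positivity) T c
    hR).trans ?_
  have l2 : 0 < log 2 := log_pos (by norm_num)
  refine mul_le_mul_of_nonneg_left ?_ (by positivity)
  refine sum_le_sum fun d _ => sum_le_sum fun i _ => sum_le_sum fun j _ => ?_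
  simp only [sqrt_sq (hpos _).le]
  rw [add_sub_add_right_eq_sub, ← sq_abs, ← sq_abs (F d - _)]
  exact pow_le_pow_left₀ (abs_nonneg _) (abs_abs_sub_abs_le _ _) 2

end Colorings

lemma multislice_eq_colorOrbit {L N : ℕ} {κ : Fin L → ℕ} {x : Fin L → ℝ} {ω₀ : Fin N → ℝ}
    (h₀ : ω₀ ∈ multislice L N κ x) : multislice L N κ x = colorOrbit univ ω₀ := by
  have hmem : ∀ ω : Fin N → ℝ, ω ∈ multislice L N κ x ↔
      (∀ i, ω i ∈ univ.image x) ∧ ∀ ℓ, colorCount univ ω (x ℓ) = κ ℓ := by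
    intro ω
    rw [multislice, mem_filter, Fintype.mem_piFinset]
    refine and_congr_right fun _ => forall_congr' fun ℓ => ?_
    rw [colorCount]
  obtain ⟨h₁, h₂⟩ := (hmem ω₀).1 h₀
  ext ω
  rw [hmem, mem_colorOrbit_iff]
  constructor
  · rintro ⟨h₃, h₄⟩
    refine ⟨fun i hi => absurd (mem_univ i) hi, fun y => ?_⟩
    by_cases hy : y ∈ univ.image x
    · obtain ⟨ℓ, -, rfl⟩ := mem_image.1 hy
      rw [h₂, h₄]
    · have hz : ∀ d : Fin N → ℝ, (∀ i, d i ∈ univ.image x) → colorCount univ d y = 0 := by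
        intro d hd
        rw [colorCount, card_eq_zero, filter_eq_empty_iff]
        rintro i - rfl
        exact hy (hd i)
      rw [hz ω h₃, hz ω₀ h₁]
  · rintro ⟨-, h⟩
    refine ⟨fun i => ?_, fun ℓ => by rw [h, h₂]⟩
    have hω : ω ∈ colorOrbit univ ω₀ :=
      mem_colorOrbit_iff.2 ⟨fun i hi => absurd (mem_univ i) hi, h⟩
    obtain ⟨j, -, hj⟩ := mem_image.1 (apply_mem_image hω (mem_univ i))
    rw [← hj]
    exact h₁ j

lemma comp_perm_mem_multislice {L N : ℕ} {κ : Fin L → ℕ} {x : Fin L → ℝ} {ω : Fin N → ℝ}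
    (hω : ω ∈ multislice L N κ x) (σ : Equiv.Perm (Fin N)) : ω ∘ σ ∈ multislice L N κ x := by
  rw [multislice_eq_colorOrbit hω]
  exact comp_perm_mem_colorOrbit (self_mem_colorOrbit _ _) fun i hi => absurd (mem_univ i) hi

/-- For a symmetric function of the first `n` coordinates, only transpositions exchanging a
sampled and an unsampled site contribute, and each of them changes a single coordinate. -/
lemma sum_swap_cost_le {L N n : ℕ} {κ : Fin L → ℕ} {x : Fin L → ℝ} (hn : n ≤ N)
    {f : (Fin n → ℝ) → ℝ}
    (hsym : ∀ ω ∈ msProj L N n κ x hn, ∀ σ : Equiv.Perm (Fin n), f (ω ∘ σ) = f ω)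
    {φ : ℝ → ℝ → ℝ} (hφ : ∀ a, φ a a = 0) {B : Fin n → ℝ} {ω : Fin N → ℝ}
    (hω : ω ∈ multislice L N κ x)
    (hB : ∀ i, ∀ ω' ∈ msProj L N n κ x hn, (∀ j, j ≠ i → ω' j = ω (Fin.castLE hn j)) →
      φ (f fun k => ω (Fin.castLE hn k)) (f ω') ≤ B i) :
    ∑ i : Fin N, ∑ j : Fin N, φ (f fun k => ω (Fin.castLE hn k))
      (f fun k => (ω ∘ Equiv.swap i j) (Fin.castLE hn k)) ≤ 2 * ((N : ℝ) - n) * ∑ i, B i := by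
  have hproj : ∀ ω' ∈ multislice L N κ x,
      (fun k => ω' (Fin.castLE hn k)) ∈ msProj L N n κ x hn :=
    fun ω' hω' => mem_image_of_mem (fun ω => fun i : Fin n => ω (Fin.castLE hn i)) hω'
  obtain ⟨m, rfl⟩ := Nat.exists_eq_add_of_le hn
  have hcast : ∀ k : Fin n, Fin.castLE hn k = Fin.castAdd m k := fun _ => rfl
  simp only [hcast] at hproj hB ⊢
  have hne : ∀ (a : Fin n) (b : Fin m), Fin.castAdd m a ≠ Fin.natAdd n b := by
    intro a b h
    have := congrArg Fin.val h
    simp at this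
    omega
  have hcross : ∀ (a : Fin n) (b : Fin m), φ (f fun k => ω (Fin.castAdd m k))
      (f fun k => (ω ∘ Equiv.swap (Fin.castAdd m a) (Fin.natAdd n b)) (Fin.castAdd m k)) ≤
        B a := by
    intro a b
    refine hB a _ (hproj _ (comp_perm_mem_multislice hω _)) fun j hj => ?_
    rw [Function.comp, Equiv.swap_apply_of_ne_of_ne _ (hne j b)]
    exact fun h => hj (Fin.castAdd_injective n m h)
  have hin : ∀ a a' : Fin n, φ (f fun k => ω (Fin.castAdd m k))
      (f fun k => (ω ∘ Equiv.swap (Fin.castAdd m a) (Fin.castAdd m a')) (Fin.castAdd m k)) =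
        0 := by
    intro a a'
    have : (fun k => (ω ∘ Equiv.swap (Fin.castAdd m a) (Fin.castAdd m a')) (Fin.castAdd m k)) =
        (fun k => ω (Fin.castAdd m k)) ∘ Equiv.swap a a' := by
      ext k
      simp only [Function.comp]
      rw [(Fin.castAdd_injective n m).swap_apply]
    rw [this, hsym _ (hproj _ hω), hφ]
  have hout : ∀ b b' : Fin m, φ (f fun k => ω (Fin.castAdd m k))
      (f fun k => (ω ∘ Equiv.swap (Fin.natAdd n b) (Fin.natAdd n b')) (Fin.castAdd m k)) =
        0 := by
    intro b b'
    have : (fun k => (ω ∘ Equiv.swap (Fin.natAdd n b) (Fin.natAdd n b')) (Fin.castAdd m k)) =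
        fun k => ω (Fin.castAdd m k) := by
      ext k
      rw [Function.comp, Equiv.swap_apply_of_ne_of_ne (hne k b) (hne k b')]
    rw [this, hφ]
  simp only [Fin.sum_univ_add, hin, hout, sum_const_zero, zero_add, add_zero]
  have h₁ := sum_le_sum fun (a : Fin n) (_ : a ∈ univ) =>
    sum_le_sum fun (b : Fin m) (_ : b ∈ univ) => hcross a b
  have h₂ := sum_le_sum fun (b : Fin m) (_ : b ∈ univ) =>
    sum_le_sum fun (a : Fin n) (_ : a ∈ univ) => hcross a b
  simp only [sum_const, card_univ, Fintype.card_fin, nsmul_eq_mul, ← mul_sum] at h₁ h₂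
  simp only [Equiv.swap_comm (Fin.natAdd n _) (Fin.castAdd m _)]
  push_cast
  linarith

/-- The values of `f` at the admissible replacements of the `i`-th coordinate of `ω`. -/
def replacementValues {L N n : ℕ} (κ : Fin L → ℕ) (x : Fin L → ℝ) (hn : n ≤ N)
    (f : (Fin n → ℝ) → ℝ) (ω : Fin n → ℝ) (i : Fin n) : Set ℝ :=
  { r : ℝ | ∃ ω' ∈ msProj L N n κ x hn, (∀ j : Fin n, j ≠ i → ω' j = ω j) ∧ r = f ω' }

lemma finite_replacementValues {L N n : ℕ} (κ : Fin L → ℕ) (x : Fin L → ℝ) (hn : n ≤ N)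
    (f : (Fin n → ℝ) → ℝ) (ω : Fin n → ℝ) (i : Fin n) :
    (replacementValues κ x hn f ω i).Finite := by
  refine ((msProj L N n κ x hn).image f).finite_toSet.subset ?_
  rintro r ⟨ω', hω', -, rfl⟩
  exact mem_image_of_mem f hω'

lemma sum_sub_sq_le {L N n : ℕ} {κ : Fin L → ℕ} {x : Fin L → ℝ} (hn : n ≤ N)
    {f : (Fin n → ℝ) → ℝ}
    (hsym : ∀ ω ∈ msProj L N n κ x hn, ∀ σ : Equiv.Perm (Fin n), f (ω ∘ σ) = f ω)
    {ω : Fin N → ℝ} (hω : ω ∈ multislice L N κ x) :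
    ∑ i : Fin N, ∑ j : Fin N, ((f fun k => ω (Fin.castLE hn k)) -
      f fun k => (ω ∘ Equiv.swap i j) (Fin.castLE hn k)) ^ 2 ≤
        4 * ((N : ℝ) - n) * msHSq L N n κ x hn f fun k => ω (Fin.castLE hn k) := by
  refine (sum_swap_cost_le hn hsym (φ := fun a b => (a - b) ^ 2)
    (B := fun i => (sSup (replacementValues κ x hn f (fun k => ω (Fin.castLE hn k)) i) -
      sInf (replacementValues κ x hn f (fun k => ω (Fin.castLE hn k)) i)) ^ 2)
    (by simp) hω fun i ω' hω' h => ?_).trans_eq ?_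
  · have hfin := finite_replacementValues κ x hn f (fun k => ω (Fin.castLE hn k)) i
    have m₁ : f ω' ∈ replacementValues κ x hn f (fun k => ω (Fin.castLE hn k)) i :=
      ⟨ω', hω', h, rfl⟩
    have m₂ : (f fun k => ω (Fin.castLE hn k)) ∈
        replacementValues κ x hn f (fun k => ω (Fin.castLE hn k)) i :=
      ⟨_, mem_image_of_mem (fun ω => fun i : Fin n => ω (Fin.castLE hn i)) hω,
        fun _ _ => rfl, rfl⟩
    refine sq_le_sq' ?_ ?_
    · linarith [le_csSup hfin.bddAbove m₁, csInf_le hfin.bddBelow m₂]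
    · linarith [le_csSup hfin.bddAbove m₂, csInf_le hfin.bddBelow m₁]
  · simp only [msHSq, replacementValues]
    ring

lemma sum_posPart_sq_le {L N n : ℕ} {κ : Fin L → ℕ} {x : Fin L → ℝ} (hn : n ≤ N)
    {f : (Fin n → ℝ) → ℝ}
    (hsym : ∀ ω ∈ msProj L N n κ x hn, ∀ σ : Equiv.Perm (Fin n), f (ω ∘ σ) = f ω)
    {ω : Fin N → ℝ} (hω : ω ∈ multislice L N κ x) :
    ∑ i : Fin N, ∑ j : Fin N, (max ((f fun k => ω (Fin.castLE hn k)) -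
      f fun k => (ω ∘ Equiv.swap i j) (Fin.castLE hn k)) 0) ^ 2 ≤
        4 * ((N : ℝ) - n) * msHPlusSq L N n κ x hn f fun k => ω (Fin.castLE hn k) := by
  refine (sum_swap_cost_le hn hsym (φ := fun a b => (max (a - b) 0) ^ 2)
    (B := fun i => ((f fun k => ω (Fin.castLE hn k)) -
      sInf (replacementValues κ x hn f (fun k => ω (Fin.castLE hn k)) i)) ^ 2)
    (by simp) hω fun i ω' hω' h => ?_).trans_eq ?_
  · have hfin := finite_replacementValues κ x hn f (fun k => ω (Fin.castLE hn k)) i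
    have m₁ : f ω' ∈ replacementValues κ x hn f (fun k => ω (Fin.castLE hn k)) i :=
      ⟨ω', hω', h, rfl⟩
    have m₂ : (f fun k => ω (Fin.castLE hn k)) ∈
        replacementValues κ x hn f (fun k => ω (Fin.castLE hn k)) i :=
      ⟨_, mem_image_of_mem (fun ω => fun i : Fin n => ω (Fin.castLE hn i)) hω,
        fun _ _ => rfl, rfl⟩
    refine pow_le_pow_left₀ (le_max_right _ _) (max_le ?_ ?_) 2
    · linarith [csInf_le hfin.bddBelow m₁]
    · linarith [csInf_le hfin.bddBelow m₂]
  · simp only [msHPlusSq, replacementValues]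
    ring

lemma sub_mul_exp_sub_le_posPart (a b : ℝ) :
    (exp a - exp b) * (a - b) ≤ (max (a - b) 0) ^ 2 * exp a + (max (b - a) 0) ^ 2 * exp b := by
  have key : ∀ u v : ℝ, v ≤ u → (exp u - exp v) * (u - v) ≤ (u - v) ^ 2 * exp u := by
    intro u v h
    have h₁ := mul_le_mul_of_nonneg_left (add_one_le_exp (v - u)) (exp_pos u).le
    rw [← exp_add, add_sub_cancel] at h₁
    nlinarith
  rcases le_total b a with h | h
  · rw [max_eq_left (sub_nonneg.2 h), max_eq_right (sub_nonpos.2 h)]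
    have := key a b h
    simpa using this
  · rw [max_eq_left (sub_nonneg.2 h), max_eq_right (sub_nonpos.2 h)]
    have := key b a h
    nlinarith

lemma sub_mul_exp_sub_le_mean (a b : ℝ) :
    (exp a - exp b) * (a - b) ≤ (a - b) ^ 2 * exp a / 2 + (b - a) ^ 2 * exp b / 2 := by
  have hmono : MonotoneOn (fun t : ℝ => t * (exp t + 1) - 2 * (exp t - 1)) (Set.Ici 0) := by
    have hderiv : ∀ t : ℝ, HasDerivAt (fun t : ℝ => t * (exp t + 1) - 2 * (exp t - 1))
        (1 * (exp t + 1) + t * exp t - 2 * exp t) t := fun t =>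
      ((hasDerivAt_id t).mul ((Real.hasDerivAt_exp t).add_const 1)).sub
        (((Real.hasDerivAt_exp t).sub_const 1).const_mul 2)
    refine monotoneOn_of_deriv_nonneg (convex_Ici 0)
      (fun t _ => (hderiv t).continuousAt.continuousWithinAt)
      (fun t _ => (hderiv t).differentiableAt.differentiableWithinAt) fun t _ => ?_
    rw [(hderiv t).deriv]
    have h₁ := mul_le_mul_of_nonneg_left (add_one_le_exp (-t)) (exp_pos t).le
    rw [← exp_add, add_neg_cancel, exp_zero] at h₁
    linarith
  have key : ∀ u v : ℝ, v ≤ u →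
      (exp u - exp v) * (u - v) ≤ (u - v) ^ 2 * (exp u + exp v) / 2 := by
    intro u v h
    have h₁ := hmono Set.self_mem_Ici (sub_nonneg.2 h) (sub_nonneg.2 h)
    simp only [exp_zero, sub_self, mul_zero, zero_mul] at h₁
    have h₂ : exp u = exp v * exp (u - v) := by rw [← exp_add, add_sub_cancel]
    have h₃ := mul_nonneg (mul_nonneg h₁ (exp_pos v).le) (sub_nonneg.2 h)
    rw [h₂]
    linarith
  rcases le_total b a with h | h
  · linarith [key a b h]
  · linarith [key b a h]

/-- Symmetrized modified logarithmic Sobolev inequality. -/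
lemma entSum_exp_le {ι K : Type*} [Fintype ι] [DecidableEq ι] (F : (ι → K) → ℝ) (T : Finset ι)
    (c : ι → K) (φ : ℝ → ℝ → ℝ)
    (hφ : ∀ a b, (exp a - exp b) * (a - b) ≤ φ a b * exp a + φ b a * exp b) :
    entSum (colorOrbit T c) (fun d => exp (F d)) ≤ 1 / T.card *
      ∑ d ∈ colorOrbit T c, (∑ i ∈ T, ∑ j ∈ T, φ (F d) (F (d ∘ Equiv.swap i j))) * exp (F d) := by
  refine (entSum_le_logEnergy (fun d => exp_pos (F d)) T c).trans ?_
  have h : ∑ d ∈ colorOrbit T c, swapEnergy (fun x y => (x - y) * (log x - log y)) T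
      (fun d => exp (F d)) d ≤ 2 * ∑ d ∈ colorOrbit T c,
        (∑ i ∈ T, ∑ j ∈ T, φ (F d) (F (d ∘ Equiv.swap i j))) * exp (F d) := by
    have h₁ : ∑ d ∈ colorOrbit T c, ∑ i ∈ T, ∑ j ∈ T,
        φ (F (d ∘ Equiv.swap i j)) (F d) * exp (F (d ∘ Equiv.swap i j)) =
        ∑ d ∈ colorOrbit T c, ∑ i ∈ T, ∑ j ∈ T,
        φ (F d) (F (d ∘ Equiv.swap i j)) * exp (F d) := by
      rw [sum_comm, sum_comm (s := colorOrbit T c)]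
      refine sum_congr rfl fun i hi => ?_
      rw [sum_comm, sum_comm (s := colorOrbit T c)]
      refine sum_congr rfl fun j hj => ?_
      rw [← sum_colorOrbit_comp_swap c hi hj]
      simp only [comp_swap_comp_swap]
    simp only [sum_mul]
    rw [two_mul]
    nth_rewrite 2 [← h₁]
    simp only [swapEnergy, ← sum_add_distrib, log_exp]
    exact sum_le_sum fun d _ => sum_le_sum fun i _ => sum_le_sum fun j _ => hφ _ _
  refine (mul_le_mul_of_nonneg_left h (by positivity)).trans_eq ?_
  rcases eq_or_ne (T.card : ℝ) 0 with h0 | h0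
  · simp [h0]
  · field_simp

lemma uent_eq_entSum_div {α : Type*} (Ω : Finset α) (g : α → ℝ) :
    uent Ω g = entSum Ω g / Ω.card := by
  rw [uent, uexpect, uexpect, entSum]
  ring

/-- Log-Sobolev and modified log-Sobolev inequalities for symmetric functions in
sampling without replacement. -/
theorem stmt17 (L N n : ℕ) (hL : 2 ≤ L) (κ : Fin L → ℕ) (hκ : ∀ ℓ, 1 ≤ κ ℓ)
    (hN : N = ∑ ℓ, κ ℓ) (x : Fin L → ℝ) (hx : StrictMono x) (hn : n ≤ N)
    (f : (Fin n → ℝ) → ℝ)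
    (hsym : ∀ ω ∈ msProj L N n κ x hn, ∀ σ : Equiv.Perm (Fin n), f (ω ∘ σ) = f ω) :
    msEntN L N n κ x hn (fun ω => f ω ^ 2) ≤
      (4 * Real.log ((N : ℝ) / (⨅ ℓ : Fin L, (κ ℓ : ℝ))) * (1 - (n : ℝ) / N) /
        Real.log 2) *
        msExpectN L N n κ x hn (msHSq L N n κ x hn f) ∧
    msEntN L N n κ x hn (fun ω => Real.exp (f ω)) ≤
      2 * (1 - (n : ℝ) / N) *
        msExpectN L N n κ x hn (fun ω => msHSq L N n κ x hn f ω * Real.exp (f ω)) ∧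
    msEntN L N n κ x hn (fun ω => Real.exp (f ω)) ≤
      4 * (1 - (n : ℝ) / N) *
        msExpectN L N n κ x hn (fun ω => msHPlusSq L N n κ x hn f ω * Real.exp (f ω)) := by
  have hcard : (Finset.univ : Finset (Fin N)).card = N := by simp
  rcases (multislice L N κ x).eq_empty_or_nonempty with he | ⟨ω₀, hω₀⟩
  · simp [msEntN, msExpectN, uent, uexpect, he]
  have horb := multislice_eq_colorOrbit hω₀
  have : Nonempty (Fin L) := ⟨⟨0, by omega⟩⟩
  have hNpos : (0 : ℝ) < N := by
    have : κ ⟨0, by omega⟩ ≤ N := hN ▸ single_le_sum (fun _ _ => Nat.zero_le _) (mem_univ _)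
    have h1 := hκ ⟨0, by omega⟩
    exact_mod_cast (by omega : 0 < N)
  have hMpos : (0 : ℝ) < (multislice L N κ x).card := by
    exact_mod_cast card_pos.2 ⟨ω₀, hω₀⟩
  have hexp : ∀ (C : ℝ) (G H : (Fin n → ℝ) → ℝ),
      entSum (multislice L N κ x) (fun ω => G fun k => ω (Fin.castLE hn k)) ≤
        C * ∑ ω ∈ multislice L N κ x, H (fun k => ω (Fin.castLE hn k)) →
      msEntN L N n κ x hn G ≤ C * msExpectN L N n κ x hn H := by
    intro C G H h
    rw [msEntN, uent_eq_entSum_div, msExpectN, uexpect, ← mul_div_assoc]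
    exact div_le_div_of_nonneg_right h hMpos.le
  have hN' : 0 ≤ 1 / (N : ℝ) := by positivity
  have hcomp : ∀ (D : ℝ) (φ : ℝ → ℝ → ℝ) (H : (Fin n → ℝ) → ℝ),
      (∀ a b, (exp a - exp b) * (a - b) ≤ φ a b * exp a + φ b a * exp b) →
      (∀ ω ∈ multislice L N κ x, ∑ i : Fin N, ∑ j : Fin N, φ (f fun k => ω (Fin.castLE hn k))
        (f fun k => (ω ∘ Equiv.swap i j) (Fin.castLE hn k)) ≤
          D * ((N : ℝ) - n) * H fun k => ω (Fin.castLE hn k)) →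
      msEntN L N n κ x hn (fun ω => exp (f ω)) ≤
        D * (1 - (n : ℝ) / N) * msExpectN L N n κ x hn (fun ω => H ω * exp (f ω)) := by
    intro D φ H hφ hH
    refine hexp _ _ _ ?_
    have h := entSum_exp_le (fun ω : Fin N → ℝ => f fun k => ω (Fin.castLE hn k)) univ ω₀ φ hφ
    rw [← horb, hcard] at h
    refine h.trans ((mul_le_mul_of_nonneg_left (sum_le_sum fun ω hω =>
      mul_le_mul_of_nonneg_right (hH ω hω) (exp_pos _).le) hN').trans_eq ?_)
    simp only [mul_assoc, ← mul_sum]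
    field_simp
  refine ⟨hexp _ _ _ ?_, hcomp 2 (fun a b => (a - b) ^ 2 / 2) _ (fun a b => ?_) fun ω hω => ?_,
    hcomp 4 (fun a b => (max (a - b) 0) ^ 2) _ sub_mul_exp_sub_le_posPart
      fun ω hω => sum_posPart_sq_le hn hsym hω⟩
  · have hinf : ∀ ℓ, (⨅ ℓ : Fin L, (κ ℓ : ℝ)) ≤ κ ℓ := ciInf_le (Set.finite_range _).bddBelow
    have hinf1 : (1 : ℝ) ≤ ⨅ ℓ : Fin L, (κ ℓ : ℝ) := le_ciInf fun ℓ => by exact_mod_cast hκ ℓ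
    set R : ℝ := N / ⨅ ℓ : Fin L, (κ ℓ : ℝ) with hR
    have hRκ : ∀ ℓ, (N : ℝ) ≤ R * κ ℓ := by
      intro ℓ
      rw [hR, div_mul_eq_mul_div, le_div_iff₀ (by linarith)]
      exact mul_le_mul_of_nonneg_left (hinf ℓ) hNpos.le
    have hR1 : 1 ≤ R := by
      rw [hR, one_le_div (by linarith)]
      refine (hinf ⟨0, by omega⟩).trans ?_
      exact_mod_cast hN ▸ single_le_sum (fun _ _ => Nat.zero_le _) (mem_univ _)
    have h := entSum_sq_le (R := R) (fun ω : Fin N → ℝ => f fun k => ω (Fin.castLE hn k)) univ ω₀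
      (by
        intro y hy
        obtain ⟨i, -, rfl⟩ := mem_image.1 hy
        rw [multislice, mem_filter, Fintype.mem_piFinset] at hω₀
        obtain ⟨ℓ, -, hℓ⟩ := mem_image.1 (hω₀.1 i)
        rw [← hℓ, colorCount, hω₀.2 ℓ, hcard]
        exact hRκ ℓ) (log_nonneg hR1)
    rw [← horb, hcard] at h
    refine h.trans ((mul_le_mul_of_nonneg_left (sum_le_sum fun ω hω =>
      sum_sub_sq_le hn hsym hω) (div_nonneg (div_nonneg (log_nonneg hR1)
        (log_nonneg one_le_two)) hNpos.le)).trans_eq ?_)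
    rw [← mul_sum]
    have := (log_pos one_lt_two).ne'
    field_simp
  · have := sub_mul_exp_sub_le_mean a b
    linarith
  · have := sum_sub_sq_le hn hsym hω
    simp only [← sum_div]
    linarith
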